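/- arXiv:1711.08196 — 7 statements merged into one kernel-verified Lean document; each statement's English description precedes it below -/
import Mathlib

section
/- For every odd positive integer L and every real p with 0 ≤ p ≤ 1/2, the majority-flip probability after one noise step satisfies the upper bound ∑_{k=(L+1)/2}^{L} C(L,k) · p^k · (1−p)^{L−k} ≤ ((L+1)/2) · C(L,(L+1)/2) · p · (p(1−p))^{(L−1)/2}. -/
/-- Upper bound for the majority-flip probability of a length-`L` repetition code
under independent Bernoulli(`p`) errors, for odd `L` and `0 ≤ p ≤ 1/2`:
`∑_{k=(L+1)/2}^{L} C(L,k) p^k (1-p)^{L-k}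
  ≤ ((L+1)/2) · C(L,(L+1)/2) · p · (p(1-p))^{(L-1)/2}`. -/
theorem binomial_tail_le (L : ℕ) (hL : 0 < L) (hodd : Odd L)
    (p : ℝ) (hp0 : 0 ≤ p) (hp1 : p ≤ 1 / 2) :
    ∑ k ∈ Finset.Icc ((L + 1) / 2) L, (L.choose k : ℝ) * p ^ k * (1 - p) ^ (L - k)
      ≤ (((L + 1) / 2 : ℕ) : ℝ) * (L.choose ((L + 1) / 2) : ℝ)
          * p * (p * (1 - p)) ^ ((L - 1) / 2) := by
  obtain ⟨m, rfl⟩ := hodd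
  have e1 : (2 * m + 1 + 1) / 2 = m + 1 := by omega
  have e2 : (2 * m + 1 - 1) / 2 = m := by omega
  rw [e1, e2]
  have hq : 0 ≤ 1 - p := by linarith
  have hpq : p ≤ 1 - p := by linarith
  have key : ∀ k ∈ Finset.Icc (m + 1) (2 * m + 1),
      ((2 * m + 1).choose k : ℝ) * p ^ k * (1 - p) ^ (2 * m + 1 - k)
        ≤ ((2 * m + 1).choose (m + 1) : ℝ) * (p ^ (m + 1) * (1 - p) ^ m) := by
    intro k hk
    rw [Finset.mem_Icc] at hk
    obtain ⟨j, rfl⟩ := Nat.exists_eq_add_of_le hk.1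
    have hj : j ≤ m := by omega
    obtain ⟨i, rfl⟩ := Nat.exists_eq_add_of_le hj
    have e3 : 2 * (j + i) + 1 - (j + i + 1 + j) = i := by omega
    rw [e3, mul_assoc]
    have hc : (2 * (j + i) + 1).choose (j + i + 1 + j)
        ≤ (2 * (j + i) + 1).choose (j + i + 1) := by
      have h := Nat.choose_le_middle (j + i + 1 + j) (2 * (j + i) + 1)
      have e4 : (2 * (j + i) + 1) / 2 = j + i := by omega
      rw [e4] at h
      rwa [Nat.choose_symm_half]
    have hc' : ((2 * (j + i) + 1).choose (j + i + 1 + j) : ℝ)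
        ≤ ((2 * (j + i) + 1).choose (j + i + 1) : ℝ) := by exact_mod_cast hc
    refine mul_le_mul hc' ?_ (by positivity) (by positivity)
    rw [pow_add p (j + i + 1) j, pow_add (1 - p) j i, mul_assoc]
    gcongr
  refine (Finset.sum_le_card_nsmul _ _ _ key).trans (le_of_eq ?_)
  have e5 : 2 * m + 1 + 1 - (m + 1) = m + 1 := by omega
  rw [Nat.card_Icc, e5, nsmul_eq_mul, mul_pow]
  ring
end

section
/- Fix reals p with 0 < p ≤ 1/2 and c with 0 < c < ∞. Define the renormalized single-site error probability p(t) = (1 − (1−2p)^t)/2 and, for odd L, the majority-flip probability P_L(t) = ∑_{k=(L+1)/2}^{L} C(L,k) · p(t)^k · (1−p(t))^{L−k}. Then the limit over odd L → ∞ of P_L(⌈L/c⌉) equals 1/2. (In other words, if global majority voting can only be applied once every ∼L/c time steps of Bernoulli(p) noise, it fails with probability 1/2 in the thermodynamic limit.) -/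
open Filter

lemma half_sum (m : ℕ) :
    ∑ k ∈ Finset.Icc (m + 1) (2 * m + 1), ((2 * m + 1).choose k : ℝ) = 4 ^ m := by
  have h1 := Nat.sum_range_choose_halfway m
  have h2 := Nat.sum_range_choose (2 * m + 1)
  have h3 := Finset.sum_range_add_sum_Ico (fun k => (2 * m + 1).choose k)
    (show m + 1 ≤ 2 * m + 1 + 1 by omega)
  have h4 : Finset.Icc (m + 1) (2 * m + 1) = Finset.Ico (m + 1) (2 * m + 1 + 1) := by
    ext; simp only [Finset.mem_Icc, Finset.mem_Ico]; omega
  rw [h4]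
  have h5 : 2 ^ (2 * m + 1) = 2 * 4 ^ m := by rw [pow_succ, pow_mul]; norm_num; ring
  have : ∑ k ∈ Finset.Ico (m + 1) (2 * m + 1 + 1), (2 * m + 1).choose k = 4 ^ m := by
    omega
  exact_mod_cast this

lemma flip_bounds (m : ℕ) (e : ℝ) (h0 : 0 ≤ e) (h1 : e ≤ 1) :
    (1 - e) ^ (2 * m + 1) / 2 ≤ ∑ k ∈ Finset.Icc (m + 1) (2 * m + 1),
      ((2 * m + 1).choose k : ℝ) * ((1 - e) / 2) ^ k * (1 - (1 - e) / 2) ^ (2 * m + 1 - k) ∧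
    ∑ k ∈ Finset.Icc (m + 1) (2 * m + 1),
      ((2 * m + 1).choose k : ℝ) * ((1 - e) / 2) ^ k * (1 - (1 - e) / 2) ^ (2 * m + 1 - k)
      ≤ (1 + e) ^ (2 * m + 1) / 2 := by
  have key : ∀ x : ℝ, x ^ (2 * m + 1) / 2 = ∑ k ∈ Finset.Icc (m + 1) (2 * m + 1),
      ((2 * m + 1).choose k : ℝ) * (x / 2) ^ (2 * m + 1) := by
    intro x
    rw [← Finset.sum_mul, half_sum, div_pow]
    have h5 : (2 : ℝ) ^ (2 * m + 1) = 2 * 4 ^ m := by rw [pow_succ, pow_mul]; norm_num; ring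
    rw [h5]
    field_simp
  have e1 : 1 - (1 - e) / 2 = (1 + e) / 2 := by ring
  rw [key, key, e1]
  have hsplit : ∀ x : ℝ, ∀ k ∈ Finset.Icc (m + 1) (2 * m + 1),
      x ^ (2 * m + 1) = x ^ k * x ^ (2 * m + 1 - k) := by
    intro x k hk
    rw [← pow_add, Nat.add_sub_cancel' (Finset.mem_Icc.1 hk).2]
  have a0 : 0 ≤ (1 - e) / 2 := by linarith
  have b0 : 0 ≤ (1 + e) / 2 := by linarith
  have ab : (1 - e) / 2 ≤ (1 + e) / 2 := by linarith
  constructor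
  · refine Finset.sum_le_sum fun k hk => ?_
    rw [hsplit _ k hk, mul_assoc]
    gcongr
  · refine Finset.sum_le_sum fun k hk => ?_
    rw [hsplit _ k hk, mul_assoc]
    gcongr


/-- If global majority voting on a length-`L` repetition code can only be applied once
every `⌈L/c⌉` time steps of Bernoulli(`p`) noise (with renormalized single-site error
probability `p(t) = (1 - (1-2p)^t)/2`), then the majority-flip probability
`P_L(⌈L/c⌉) = ∑_{k=(L+1)/2}^{L} C(L,k) p(t)^k (1-p(t))^{L-k}` tends to `1/2`
in the limit of odd `L → ∞`, for every `0 < p ≤ 1/2` and `0 < c`. -/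
theorem majority_flip_limit_one_half (p c : ℝ) (hp0 : 0 < p) (hp1 : p ≤ 1 / 2)
    (hc : 0 < c) :
    Tendsto
      (fun L : ℕ =>
        ∑ k ∈ Finset.Icc ((L + 1) / 2) L,
          (L.choose k : ℝ)
            * ((1 - (1 - 2 * p) ^ (Nat.ceil ((L : ℝ) / c))) / 2) ^ k
            * (1 - (1 - (1 - 2 * p) ^ (Nat.ceil ((L : ℝ) / c))) / 2) ^ (L - k))
      (atTop ⊓ 𝓟 {L | Odd L}) (nhds (1 / 2)) := by
  have ha0 : 0 ≤ 1 - 2 * p := by linarith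
  have ha1 : 1 - 2 * p < 1 := by linarith
  set a := 1 - 2 * p with ha
  have hr0 : 0 ≤ a ^ (1 / c) := Real.rpow_nonneg ha0 _
  have hr1 : a ^ (1 / c) < 1 := Real.rpow_lt_one ha0 ha1 (by positivity)
  have hle : ∀ L : ℕ, a ^ (Nat.ceil ((L : ℝ) / c)) ≤ (a ^ (1 / c)) ^ L := by
    intro L
    rw [← Real.rpow_natCast a, ← Real.rpow_natCast (a ^ (1 / c)), ← Real.rpow_mul ha0]
    apply Real.rpow_le_rpow_of_exponent_ge' ha0 ha1.le (by positivity)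
    calc 1 / c * (L : ℝ) = L / c := by ring
      _ ≤ _ := Nat.le_ceil _
  have hlim := tendsto_self_mul_const_pow_of_lt_one hr0 hr1
  have hLe : Tendsto (fun L : ℕ => (L : ℝ) * a ^ (Nat.ceil ((L : ℝ) / c))) atTop (nhds 0) := by
    refine squeeze_zero (fun L => by positivity) (fun L => ?_) hlim
    exact mul_le_mul_of_nonneg_left (hle L) (by positivity)
  have hlo : Tendsto (fun L : ℕ => (1 - (L : ℝ) * a ^ (Nat.ceil ((L : ℝ) / c))) / 2)
      (atTop ⊓ 𝓟 {L | Odd L}) (nhds (1 / 2)) := by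
    have := (hLe.const_sub 1).div_const 2
    rw [sub_zero] at this
    exact this.mono_left inf_le_left
  have hhi : Tendsto (fun L : ℕ => Real.exp ((L : ℝ) * a ^ (Nat.ceil ((L : ℝ) / c))) / 2)
      (atTop ⊓ 𝓟 {L | Odd L}) (nhds (1 / 2)) := by
    have := ((Real.continuous_exp.tendsto 0).comp hLe).div_const 2
    rw [Real.exp_zero] at this
    exact this.mono_left inf_le_left
  refine tendsto_of_tendsto_of_tendsto_of_le_of_le' hlo hhi ?_ ?_
  · rw [eventually_inf_principal]
    refine Eventually.of_forall fun L hL => ?_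
    obtain ⟨m, rfl⟩ := hL
    have e0 : 0 ≤ a ^ (Nat.ceil (((2 * m + 1 : ℕ) : ℝ) / c)) := by positivity
    have e1 : a ^ (Nat.ceil (((2 * m + 1 : ℕ) : ℝ) / c)) ≤ 1 := pow_le_one₀ ha0 ha1.le
    have h := (flip_bounds m _ e0 e1).1
    have hm : (2 * m + 1 + 1) / 2 = m + 1 := by omega
    rw [hm]
    refine le_trans ?_ h
    have := one_add_mul_le_pow (a := -a ^ (Nat.ceil (((2 * m + 1 : ℕ) : ℝ) / c)))
      (by linarith) (2 * m + 1)
    rw [← sub_eq_add_neg] at this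
    linarith
  · rw [eventually_inf_principal]
    refine Eventually.of_forall fun L hL => ?_
    obtain ⟨m, rfl⟩ := hL
    have e0 : 0 ≤ a ^ (Nat.ceil (((2 * m + 1 : ℕ) : ℝ) / c)) := by positivity
    have e1 : a ^ (Nat.ceil (((2 * m + 1 : ℕ) : ℝ) / c)) ≤ 1 := pow_le_one₀ ha0 ha1.le
    have h := (flip_bounds m _ e0 e1).2
    have hm : (2 * m + 1 + 1) / 2 = m + 1 := by omega
    rw [hm]
    refine le_trans h ?_
    rw [Real.exp_nat_mul]
    gcongr
    rw [add_comm]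
    exact Real.add_one_le_exp _
end

section
/- Let L, D be positive integers, let p be a real with 0 ≤ p ≤ 1/2, and let Δ : (Fin (L−1) → Bool) → (Fin L → Bool) be any D-local decoder. Fix a site i with D+1 ≤ i ≤ L−D (so the full radius-D window around i lies inside the chain). If x : Fin L → Bool is drawn from the product Bernoulli(p) measure, then the probability that decoding succeeds at site i, i.e., Pr(Δ_i(∂x) ⊕ x_i = 0), is at most [1 + (p/(1−p))^{2D+1}]^{−1}. -/
/-- The syndrome of an error pattern `x : Fin L → Bool`:
`(∂x)_j = x_j ⊕ x_{j+1}`. -/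
def syndrome {L : ℕ} (x : Fin L → Bool) : Fin (L - 1) → Bool :=
  fun j =>
    xor (x ⟨j.val, by have := j.isLt; omega⟩) (x ⟨j.val + 1, by have := j.isLt; omega⟩)

/-- A decoder `Δ` (mapping syndromes to correction patterns) is `D`-local if its
output bit at site `i` only depends on the syndrome bits `(∂x)_j` whose two
sites `j, j+1` are both within distance `D` of `i`. -/
def DLocal {L : ℕ} (D : ℕ) (Δ : (Fin (L - 1) → Bool) → Fin L → Bool) : Prop :=
  ∀ i : Fin L, ∀ s s' : Fin (L - 1) → Bool,
    (∀ j : Fin (L - 1),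
        ((i.val : ℤ) - D ≤ (j.val : ℤ) ∧ (j.val : ℤ) + 1 ≤ (i.val : ℤ) + D) →
        s j = s' j) →
    Δ s i = Δ s' i

/-- The product Bernoulli(`p`) weight of an error pattern `x : Fin L → Bool`. -/
def bernoulliWeight (p : ℝ) {L : ℕ} (x : Fin L → Bool) : ℝ :=
  p ^ (Finset.univ.filter (fun i : Fin L => x i = true)).card
    * (1 - p) ^ (Finset.univ.filter (fun i : Fin L => x i = false)).card


def winFlip {L : ℕ} (D : ℕ) (i : Fin L) (x : Fin L → Bool) : Fin L → Bool :=
  fun j => xor (x j) (decide (i.val ≤ j.val + D ∧ j.val ≤ i.val + D))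

lemma winFlip_invol {L : ℕ} (D : ℕ) (i : Fin L) : Function.Involutive (winFlip D i) := by
  intro x
  funext j
  simp [winFlip]

lemma win_card {L : ℕ} (D : ℕ) (i : Fin L) (hi1 : D ≤ i.val) (hi2 : i.val + D + 1 ≤ L) :
    (Finset.univ.filter (fun j : Fin L => i.val ≤ j.val + D ∧ j.val ≤ i.val + D)).card
      = 2 * D + 1 := by
  rw [← Finset.card_map Fin.valEmbedding]
  have : (Finset.univ.filter (fun j : Fin L => i.val ≤ j.val + D ∧ j.val ≤ i.val + D)).map
      Fin.valEmbedding = Finset.Icc (i.val - D) (i.val + D) := by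
    ext n
    simp only [Finset.mem_map, Finset.mem_filter, Finset.mem_univ, true_and, Finset.mem_Icc,
      Fin.valEmbedding_apply]
    constructor
    · rintro ⟨a, ha, rfl⟩
      omega
    · intro h
      exact ⟨⟨n, by omega⟩, by simp only []; omega, rfl⟩
  rw [this, Nat.card_Icc]
  omega

lemma weight_eq_prod (p : ℝ) {L : ℕ} (x : Fin L → Bool) :
    bernoulliWeight p x = ∏ j, (if x j = true then p else 1 - p) := by
  rw [Finset.prod_ite]
  simp [bernoulliWeight]

lemma weight_sum (p : ℝ) (L : ℕ) : ∑ x : Fin L → Bool, bernoulliWeight p x = 1 := by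
  simp_rw [weight_eq_prod]
  have h := Finset.prod_univ_sum (fun _ : Fin L => (Finset.univ : Finset Bool))
    (fun _ b => if b = true then p else 1 - p)
  rw [Fintype.piFinset_univ] at h
  rw [← h]
  simp

lemma weight_flip (p : ℝ) (hp0 : 0 ≤ p) (hp1 : p ≤ 1 / 2) {L : ℕ} (D : ℕ) (i : Fin L)
    (hi1 : D ≤ i.val) (hi2 : i.val + D + 1 ≤ L) (x : Fin L → Bool) :
    (p / (1 - p)) ^ (2 * D + 1) * bernoulliWeight p x ≤ bernoulliWeight p (winFlip D i x) := by
  have h1 : 0 < 1 - p := by linarith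
  have hr0 : 0 ≤ p / (1 - p) := by positivity
  have hr1 : p / (1 - p) ≤ 1 := by rw [div_le_one h1]; linarith
  rw [← win_card D i hi1 hi2, ← Finset.prod_const, Finset.prod_filter, weight_eq_prod,
    weight_eq_prod, ← Finset.prod_mul_distrib]
  apply Finset.prod_le_prod
  · intro j _
    apply mul_nonneg <;> split_ifs <;> first | assumption | linarith
  · intro j _
    by_cases hj : i.val ≤ j.val + D ∧ j.val ≤ i.val + D
    · cases hx : x j
      · simp [winFlip, hj, hx, h1.ne']
      · simp only [winFlip, hj, hx]
        simp
        nlinarith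
    · simp [winFlip, hj]

lemma decode_flip {L D : ℕ} (Δ : (Fin (L - 1) → Bool) → Fin L → Bool) (hΔ : DLocal D Δ)
    (i : Fin L) (x : Fin L → Bool) :
    Δ (syndrome (winFlip D i x)) i = Δ (syndrome x) i := by
  apply hΔ
  intro j hj
  have a1 : i.val ≤ j.val + D ∧ j.val ≤ i.val + D := by omega
  have a2 : i.val ≤ j.val + 1 + D ∧ j.val + 1 ≤ i.val + D := by omega
  simp only [syndrome, winFlip, a1, a2]
  simp

/-- Single-site light-cone constraint: for any `D`-local decoder `Δ` on a chain of
length `L`, any `0 ≤ p ≤ 1/2`, and any site `i` whose radius-`D` window lies inside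
the chain (`D+1 ≤ i ≤ L-D` in 1-based indexing), the probability (w.r.t. the product
Bernoulli(`p`) measure on error patterns) that decoding succeeds at site `i`,
i.e. `Δ_i(∂x) ⊕ x_i = 0`, is at most `[1 + (p/(1-p))^{2D+1}]⁻¹`. -/
theorem single_site_light_cone_constraint (L D : ℕ) (hL : 0 < L) (hD : 0 < D)
    (p : ℝ) (hp0 : 0 ≤ p) (hp1 : p ≤ 1 / 2)
    (Δ : (Fin (L - 1) → Bool) → Fin L → Bool) (hΔ : DLocal D Δ)
    (i : Fin L) (hi1 : D ≤ i.val) (hi2 : i.val + D + 1 ≤ L) :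
    ∑ x : Fin L → Bool,
        (if xor (Δ (syndrome x) i) (x i) = false then bernoulliWeight p x else 0)
      ≤ (1 + (p / (1 - p)) ^ (2 * D + 1))⁻¹ := by
  have h1 : 0 < 1 - p := by linarith
  have hr0 : 0 ≤ (p / (1 - p)) ^ (2 * D + 1) := by positivity
  set r := (p / (1 - p)) ^ (2 * D + 1) with hr
  rw [← one_div, le_div_iff₀ (by linarith)]
  have key : r * ∑ x : Fin L → Bool,
        (if xor (Δ (syndrome x) i) (x i) = false then bernoulliWeight p x else 0)
      ≤ ∑ x : Fin L → Bool,
        (if xor (Δ (syndrome x) i) (x i) = false then 0 else bernoulliWeight p x) := by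
    rw [← Equiv.sum_comp (winFlip_invol D i).toPerm
      (fun x => if xor (Δ (syndrome x) i) (x i) = false then 0 else bernoulliWeight p x),
      Finset.mul_sum]
    apply Finset.sum_le_sum
    intro x _
    have hw := weight_flip p hp0 hp1 D i hi1 hi2 x
    have hxi : winFlip D i x i = !(x i) := by simp [winFlip]
    simp only [Function.Involutive.coe_toPerm, decode_flip Δ hΔ, hxi]
    cases Δ (syndrome x) i <;> cases x i <;> simp <;> exact hw
  have tot : (∑ x : Fin L → Bool,
        (if xor (Δ (syndrome x) i) (x i) = false then bernoulliWeight p x else 0))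
      + ∑ x : Fin L → Bool,
        (if xor (Δ (syndrome x) i) (x i) = false then 0 else bernoulliWeight p x) = 1 := by
    rw [← Finset.sum_add_distrib, ← weight_sum p L]
    apply Finset.sum_congr rfl
    intro x _
    split_ifs <;> simp
  linarith
end

section
/- Let D be a positive integer, let p be a real with 0 ≤ p ≤ 1/2, and let L = (2D+1)·n for a positive integer n. For any D-local decoder Δ : (Fin (L−1) → Bool) → (Fin L → Bool), the probability (with respect to the product Bernoulli(p) measure on error patterns x : Fin L → Bool) that decoding succeeds globally, i.e., Pr(Δ(∂x) ⊕ x = 0), is at most [1 + (p/(1−p))^{2D+1}]^{−L/(2D+1)}. (Light cone constraint for D-local decoders.) -/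
lemma lcc_weight (p : ℝ) {L : ℕ} (x : Fin L → Bool) :
    bernoulliWeight p x = ∏ i, (if x i = true then p else 1 - p) := by
  unfold bernoulliWeight
  rw [Finset.prod_ite]
  simp

lemma lcc_block (m : ℕ) (p : ℝ) (hp0 : 0 ≤ p) (hp1 : p ≤ 1 / 2)
    (g : (Fin m → Bool) → ℝ) (hg0 : ∀ y, 0 ≤ g y)
    (hg : ∀ y, g y + g (fun i => !(y i)) = 1) :
    ∑ y : Fin m → Bool, g y * ∏ j, (if y j = true then p else 1 - p)
      ≤ (1 + (p / (1 - p)) ^ m)⁻¹ := by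
  have hq : 0 < 1 - p := by linarith
  have hr0 : 0 ≤ p / (1 - p) := by positivity
  have hr1 : p / (1 - p) ≤ 1 := by rw [div_le_one hq]; linarith
  set W : (Fin m → Bool) → ℝ := fun y => ∏ j, (if y j = true then p else 1 - p) with hW
  have hsum : ∑ y, W y = 1 := by
    have := Finset.prod_univ_sum (fun _ : Fin m => (Finset.univ : Finset Bool))
      (fun _ b => if b = true then p else 1 - p)
    rw [Fintype.piFinset_univ] at this
    rw [hW, ← this]
    simp
  have hflip : ∀ y, (p / (1 - p)) ^ m * W y ≤ W (fun i => !(y i)) := by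
    intro y
    have h1 : (p / (1 - p)) ^ m = ∏ _j : Fin m, (p / (1 - p)) := by
      rw [Finset.prod_const, Finset.card_univ, Fintype.card_fin]
    rw [hW, h1, ← Finset.prod_mul_distrib]
    apply Finset.prod_le_prod
    · intro j _
      split_ifs <;> positivity
    · intro j _
      rcases hy : y j with _ | _
      · simp [hy]
        rw [div_mul_cancel₀ _ hq.ne']
      · simp [hy]
        nlinarith
  let inv : (Fin m → Bool) ≃ (Fin m → Bool) :=
    ⟨fun y i => !(y i), fun y i => !(y i), fun y => by simp, fun y => by simp⟩
  have hre : ∑ y, g y * W (fun i => !(y i)) = ∑ y, g (fun i => !(y i)) * W y := by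
    rw [← Equiv.sum_comp inv]
    simp [inv]
  have h2 : (p / (1 - p)) ^ m * ∑ y, g y * W y ≤ ∑ y, g y * W (fun i => !(y i)) := by
    rw [Finset.mul_sum]
    apply Finset.sum_le_sum
    intro y _
    have := mul_le_mul_of_nonneg_left (hflip y) (hg0 y)
    linarith
  have h3 : ∑ y, g y * W y + ∑ y, g (fun i => !(y i)) * W y = 1 := by
    rw [← Finset.sum_add_distrib, ← hsum]
    apply Finset.sum_congr rfl
    intro y _
    rw [← add_mul, hg, one_mul]
  have hpos : 0 < 1 + (p / (1 - p)) ^ m := by positivity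
  rw [← one_div, le_div_iff₀ hpos]
  linarith

lemma lcc_syndrome_not {L : ℕ} (x : Fin L → Bool) :
    syndrome (fun i => !(x i)) = syndrome x := by
  funext j
  simp [syndrome]

/-- Light cone constraint for `D`-local decoders: on a chain of length
`L = (2D+1)·n`, for any `D`-local decoder `Δ` and `0 ≤ p ≤ 1/2`, the probability
(w.r.t. the product Bernoulli(`p`) measure on error patterns `x`) that decoding
succeeds globally, i.e. `Δ(∂x) ⊕ x = 0`, is at most
`[1 + (p/(1-p))^{2D+1}]^{-L/(2D+1)}`. -/
theorem light_cone_constraint (D n : ℕ) (hD : 0 < D) (hn : 0 < n)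
    (p : ℝ) (hp0 : 0 ≤ p) (hp1 : p ≤ 1 / 2)
    (Δ : (Fin ((2 * D + 1) * n - 1) → Bool) → Fin ((2 * D + 1) * n) → Bool)
    (hΔ : DLocal D Δ) :
    ∑ x : Fin ((2 * D + 1) * n) → Bool,
        (if (∀ i, xor (Δ (syndrome x) i) (x i) = false) then bernoulliWeight p x else 0)
      ≤ ((1 + (p / (1 - p)) ^ (2 * D + 1))⁻¹) ^ n := by
  classical
  let E : Fin n × Fin (2 * D + 1) ≃ Fin ((2 * D + 1) * n) :=
    finProdFinEquiv.trans (finCongr (Nat.mul_comm _ _))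
  have hE : ∀ k j, (E (k, j)).val = j.val + (2 * D + 1) * k.val := by
    intro k j; simp [E]
  let X : (Fin n → Fin (2 * D + 1) → Bool) ≃ (Fin ((2 * D + 1) * n) → Bool) :=
    (Equiv.curry _ _ _).symm.trans (Equiv.arrowCongr E (Equiv.refl _))
  have hX : ∀ z k j, X z (E (k, j)) = z k j := by
    intro z k j; simp [X, Equiv.arrowCongr]
  let c : Fin (2 * D + 1) := ⟨D, by omega⟩
  let g : Fin n → (Fin (2 * D + 1) → Bool) → ℝ := fun k y =>
    if Δ (syndrome (X (fun _ => y))) (E (k, c)) = y c then 1 else 0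
  have hloc : ∀ z k, Δ (syndrome (X z)) (E (k, c)) =
      Δ (syndrome (X (fun _ => z k))) (E (k, c)) := by
    intro z k
    apply hΔ
    intro j hj
    rw [hE] at hj
    simp only [c] at hj
    push_cast at hj
    have key : ∀ t : Fin ((2 * D + 1) * n), (2 * D + 1) * k.val ≤ t.val →
        t.val ≤ (2 * D + 1) * k.val + 2 * D → X z t = X (fun _ => z k) t := by
      intro t h1 h2
      have : t = E (k, ⟨t.val - (2 * D + 1) * k.val, by omega⟩) := by
        apply Fin.ext
        rw [hE]
        simp only
        omega
      rw [this, hX, hX]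
    have e : (((2 * D + 1) * k.val : ℕ) : ℤ) = (2 * D + 1) * k.val := by push_cast; ring
    rw [← e] at hj
    unfold syndrome
    rw [key _ (by simp only; omega) (by simp only; omega),
      key _ (by simp only; omega) (by simp only; omega)]
  have hg0 : ∀ k y, 0 ≤ g k y := by
    intro k y; simp only [g]; split_ifs <;> norm_num
  have hg : ∀ k y, g k y + g k (fun i => !(y i)) = 1 := by
    intro k y
    have h1 : X (fun _ i => !(y i)) = fun i => !(X (fun _ => y) i) := by
      funext i
      obtain ⟨⟨a, b⟩, rfl⟩ := E.surjective i
      rw [hX, hX]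
    simp only [g]
    rw [h1, lcc_syndrome_not]
    rcases Δ (syndrome (X (fun _ => y))) (E (k, c)) with _ | _ <;>
      rcases Bool.eq_false_or_eq_true (y c) with hy | hy <;> simp [hy]
  have hw0 : ∀ b : Bool, 0 ≤ (if b = true then p else 1 - p) := by
    intro b; split_ifs <;> linarith
  rw [← Equiv.sum_comp X]
  calc _ ≤ ∑ z : Fin n → Fin (2 * D + 1) → Bool,
        ∏ k, (g k (z k) * ∏ j, (if z k j = true then p else 1 - p)) := by
        apply Finset.sum_le_sum
        intro z _
        split_ifs with h
        · rw [lcc_weight, ← Equiv.prod_comp E, Fintype.prod_prod_type]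
          apply le_of_eq
          apply Finset.prod_congr rfl
          intro k _
          have h1 : g k (z k) = 1 := by
            have := h (E (k, c))
            rw [hloc, hX] at this
            simp only [g]
            rw [if_pos]
            simpa using this
          rw [h1, one_mul]
          simp only [hX]
        · exact Finset.prod_nonneg fun k _ => mul_nonneg (hg0 _ _)
            (Finset.prod_nonneg fun j _ => hw0 _)
    _ = ∏ k, ∑ y : Fin (2 * D + 1) → Bool,
          (g k y * ∏ j, (if y j = true then p else 1 - p)) := by
        rw [Finset.prod_univ_sum, Fintype.piFinset_univ]
    _ ≤ ∏ _k : Fin n, (1 + (p / (1 - p)) ^ (2 * D + 1))⁻¹ := by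
        apply Finset.prod_le_prod
        · intro k _
          exact Finset.sum_nonneg fun y _ => mul_nonneg (hg0 _ _)
            (Finset.prod_nonneg fun j _ => hw0 _)
        · intro k _
          exact lcc_block _ p hp0 hp1 (g k) (hg0 k) (hg k)
    _ = _ := by simp
end

section
/- The finite mirrored two-line voting automaton is a finite-size linear eroder with constants a = 1/45 and slope 10: for every even L and every nonempty S ⊆ {1,…,L}, if l denotes the number of sites in the smallest interval containing S (so l ≥ 1) and l ≤ L/45, then TLV̄^t(1_S) is identically false for every t ≥ 10·l. -/
/-- Boolean majority of three bits. -/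
def maj3 (a b c : Bool) : Bool := (a && b) || (a && c) || (b && c)

/-- The finite mirrored two-line voting automaton `TLV̄` on sites `{1,…,L}` (`L` even),
acting on configurations `x : ℤ → Bool` supported on `{1,…,L}`: bulk TLV rules
`(TLV̄ x)_i = maj[x_{i-1}, x_{i+2}, x_{i+4}]` for even `i ≤ L-4` and
`(TLV̄ x)_i = maj[x_{i+1}, x_{i-2}, x_{i-4}]` for odd `i ≥ 5`, together with the
mirrored-boundary rules at sites `1, 3, L-2, L`. -/
def TLVbar (L : ℕ) (x : ℤ → Bool) : ℤ → Bool := fun i =>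
  if i < 1 ∨ (L : ℤ) < i then false
  else if i = 1 then maj3 (x 2) (x 2) (x 4)
  else if i = 3 then maj3 (x 4) (x 1) (x 2)
  else if i = (L : ℤ) then maj3 (x ((L : ℤ) - 1)) (x ((L : ℤ) - 1)) (x ((L : ℤ) - 3))
  else if i = (L : ℤ) - 2 then maj3 (x ((L : ℤ) - 3)) (x (L : ℤ)) (x ((L : ℤ) - 1))
  else if i % 2 = 0 then maj3 (x (i - 1)) (x (i + 2)) (x (i + 4))
  else maj3 (x (i + 1)) (x (i - 2)) (x (i - 4))

theorem maj3_pairs {a b c : Bool} (h : maj3 a b c = true) :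
    (a = true ∧ b = true) ∨ (a = true ∧ c = true) ∨ (b = true ∧ c = true) := by
  revert h; cases a <;> cases b <;> cases c <;> simp [maj3]

/-- All true sites are even in `[A,B]` or odd in `[C,D]`. -/
def InBox (x : ℤ → Bool) (A B C D : ℤ) : Prop :=
  ∀ i, x i = true → (i % 2 = 0 ∧ A ≤ i ∧ i ≤ B) ∨ (i % 2 = 1 ∧ C ≤ i ∧ i ≤ D)

theorem inBox_congr {x : ℤ → Bool} {A B C D A' B' C' D' : ℤ} (h : InBox x A B C D)
    (hA : A' ≤ A) (hB : B ≤ B') (hC : C' ≤ C) (hD : D ≤ D') : InBox x A' B' C' D' := by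
  intro i hi
  have := h i hi
  omega

theorem bulk1 {L : ℕ} (hL : (L : ℤ) % 2 = 0) (hL2 : 10 ≤ (L : ℤ)) {x : ℤ → Bool} {A B C D : ℤ}
    (h : InBox x A B C D) (hA : 3 ≤ A) (hC : 3 ≤ C) (hB : B ≤ L - 2) (hD : D ≤ L - 2) :
    InBox (TLVbar L x) (A - 4) (B - 2) (C + 2) (D + 4) := by
  intro i hi
  unfold TLVbar at hi
  split_ifs at hi <;>
  · rcases maj3_pairs hi with ⟨h1, h2⟩ | ⟨h1, h2⟩ | ⟨h1, h2⟩ <;>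
    · have h1 := h _ h1
      have h2 := h _ h2
      omega

theorem bulk2 {L : ℕ} (hL : (L : ℤ) % 2 = 0) (hL2 : 10 ≤ (L : ℤ)) {x : ℤ → Bool} {A B C D : ℤ}
    (h : InBox x A B C D) (hA : 3 ≤ A) (hC : 3 ≤ C) (hB : B ≤ L - 2) (hD : D ≤ L - 2) (hBC : B < C + 3) :
    InBox (TLVbar L x) (A - 2) (B - 4) (C + 4) (D + 2) := by
  intro i hi
  unfold TLVbar at hi
  split_ifs at hi <;>
  · rcases maj3_pairs hi with ⟨h1, h2⟩ | ⟨h1, h2⟩ | ⟨h1, h2⟩ <;>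
    · have h1 := h _ h1
      have h2 := h _ h2
      omega

theorem left1 {L : ℕ} (hL : (L : ℤ) % 2 = 0) (hL2 : 10 ≤ (L : ℤ)) {x : ℤ → Bool} {B D : ℤ}
    (h : InBox x 1 B 1 D) (hB : B ≤ L - 4) (hD : D ≤ L - 4) (hD0 : 0 ≤ D) :
    InBox (TLVbar L x) 1 (B - 2) 1 (D + 4) := by
  intro i hi
  unfold TLVbar at hi
  split_ifs at hi <;>
  · rcases maj3_pairs hi with ⟨h1, h2⟩ | ⟨h1, h2⟩ | ⟨h1, h2⟩ <;>
    · have h1 := h _ h1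
      have h2 := h _ h2
      omega

theorem left2 {L : ℕ} (hL : (L : ℤ) % 2 = 0) (hL2 : 10 ≤ (L : ℤ)) {x : ℤ → Bool} {C D : ℤ}
    (h : InBox x 1 0 C D) (hD : D ≤ L - 4) :
    InBox (TLVbar L x) 1 0 (C + 4) (D + 2) := by
  intro i hi
  unfold TLVbar at hi
  split_ifs at hi <;>
  · rcases maj3_pairs hi with ⟨h1, h2⟩ | ⟨h1, h2⟩ | ⟨h1, h2⟩ <;>
    · have h1 := h _ h1
      have h2 := h _ h2
      omega

theorem right1 {L : ℕ} (hL : (L : ℤ) % 2 = 0) (hL2 : 10 ≤ (L : ℤ)) {x : ℤ → Bool} {A C : ℤ}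
    (h : InBox x A L C L) (hA : 5 ≤ A) (hC : 5 ≤ C) (hA0 : A ≤ L + 1) :
    InBox (TLVbar L x) (A - 4) L (C + 2) L := by
  intro i hi
  unfold TLVbar at hi
  split_ifs at hi <;>
  · rcases maj3_pairs hi with ⟨h1, h2⟩ | ⟨h1, h2⟩ | ⟨h1, h2⟩ <;>
    · have h1 := h _ h1
      have h2 := h _ h2
      omega

theorem right2 {L : ℕ} (hL : (L : ℤ) % 2 = 0) (hL2 : 10 ≤ (L : ℤ)) {x : ℤ → Bool} {A B : ℤ}
    (h : InBox x A B (L + 1) L) (hA : 5 ≤ A) :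
    InBox (TLVbar L x) (A - 2) (B - 4) (L + 1) L := by
  intro i hi
  unfold TLVbar at hi
  split_ifs at hi <;>
  · rcases maj3_pairs hi with ⟨h1, h2⟩ | ⟨h1, h2⟩ | ⟨h1, h2⟩ <;>
    · have h1 := h _ h1
      have h2 := h _ h2
      omega

theorem bulk1_it {L : ℕ} (hL : (L : ℤ) % 2 = 0) (hL2 : 10 ≤ (L : ℤ)) {x : ℤ → Bool} {A B C D : ℤ}
    (h : InBox x A B C D) (n : ℕ) (hA : 3 ≤ A - 4 * (n - 1)) (hC : 3 ≤ C) (hB : B ≤ L - 2) (hD : D + 4 * (n - 1) ≤ L - 2) :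
    InBox ((TLVbar L)^[n] x) (A - 4 * n) (B - 2 * n) (C + 2 * n) (D + 4 * n) := by
  induction n with
  | zero => simpa using h
  | succ n ih =>
    rw [Function.iterate_succ_apply']
    push_cast at *
    refine inBox_congr (bulk1 hL hL2 (ih (by omega) (by omega)) (by omega) (by omega) (by omega) (by omega)) ?_ ?_ ?_ ?_ <;> omega

theorem bulk2_it {L : ℕ} (hL : (L : ℤ) % 2 = 0) (hL2 : 10 ≤ (L : ℤ)) {x : ℤ → Bool} {A B C D : ℤ}
    (h : InBox x A B C D) (n : ℕ) (hA : 3 ≤ A - 2 * (n - 1)) (hC : 3 ≤ C) (hB : B ≤ L - 2) (hD : D + 2 * (n - 1) ≤ L - 2) (hBC : B < C + 3) :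
    InBox ((TLVbar L)^[n] x) (A - 2 * n) (B - 4 * n) (C + 4 * n) (D + 2 * n) := by
  induction n with
  | zero => simpa using h
  | succ n ih =>
    rw [Function.iterate_succ_apply']
    push_cast at *
    refine inBox_congr (bulk2 hL hL2 (ih (by omega) (by omega)) (by omega) (by omega) (by omega) (by omega) (by omega)) ?_ ?_ ?_ ?_ <;> omega

theorem left1_it {L : ℕ} (hL : (L : ℤ) % 2 = 0) (hL2 : 10 ≤ (L : ℤ)) {x : ℤ → Bool} {B D : ℤ}
    (h : InBox x 1 B 1 D) (n : ℕ) (hB : B ≤ L - 4) (hD : D + 4 * (n - 1) ≤ L - 4) (hD0 : 0 ≤ D) :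
    InBox ((TLVbar L)^[n] x) 1 (B - 2 * n) 1 (D + 4 * n) := by
  induction n with
  | zero => simpa using h
  | succ n ih =>
    rw [Function.iterate_succ_apply']
    push_cast at *
    refine inBox_congr (left1 hL hL2 (ih (by omega)) (by omega) (by omega) (by omega)) ?_ ?_ ?_ ?_ <;> omega

theorem left2_it {L : ℕ} (hL : (L : ℤ) % 2 = 0) (hL2 : 10 ≤ (L : ℤ)) {x : ℤ → Bool} {C D : ℤ}
    (h : InBox x 1 0 C D) (n : ℕ) (hD : D + 2 * (n - 1) ≤ L - 4) :
    InBox ((TLVbar L)^[n] x) 1 0 (C + 4 * n) (D + 2 * n) := by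
  induction n with
  | zero => simpa using h
  | succ n ih =>
    rw [Function.iterate_succ_apply']
    push_cast at *
    refine inBox_congr (left2 hL hL2 (ih (by omega)) (by omega)) ?_ ?_ ?_ ?_ <;> omega

theorem right1_it {L : ℕ} (hL : (L : ℤ) % 2 = 0) (hL2 : 10 ≤ (L : ℤ)) {x : ℤ → Bool} {A C : ℤ}
    (h : InBox x A L C L) (n : ℕ) (hA : 5 ≤ A - 4 * (n - 1)) (hC : 5 ≤ C) (hA0 : A ≤ L + 1) :
    InBox ((TLVbar L)^[n] x) (A - 4 * n) L (C + 2 * n) L := by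
  induction n with
  | zero => simpa using h
  | succ n ih =>
    rw [Function.iterate_succ_apply']
    push_cast at *
    refine inBox_congr (right1 hL hL2 (ih (by omega)) (by omega) (by omega) (by omega)) ?_ ?_ ?_ ?_ <;> omega

theorem right2_it {L : ℕ} (hL : (L : ℤ) % 2 = 0) (hL2 : 10 ≤ (L : ℤ)) {x : ℤ → Bool} {A B : ℤ}
    (h : InBox x A B (L + 1) L) (n : ℕ) (hA : 5 ≤ A - 2 * (n - 1)) :
    InBox ((TLVbar L)^[n] x) (A - 2 * n) (B - 4 * n) (L + 1) L := by
  induction n with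
  | zero => simpa using h
  | succ n ih =>
    rw [Function.iterate_succ_apply']
    push_cast at *
    refine inBox_congr (right2 hL hL2 (ih (by omega)) (by omega)) ?_ ?_ ?_ ?_ <;> omega

theorem zero_step {L : ℕ} : TLVbar L (fun _ => false) = fun _ => false := by
  funext i
  simp [TLVbar, maj3]

theorem empty_done {L : ℕ} {x : ℤ → Bool} {A B C D : ℤ} {n m t : ℕ}
    (h : InBox ((TLVbar L)^[m] ((TLVbar L)^[n] x)) A B C D) (hAB : B < A) (hCD : D < C)
    (ht : m + n ≤ t) : (TLVbar L)^[t] x = fun _ => false := by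
  have h0 : (TLVbar L)^[m] ((TLVbar L)^[n] x) = fun _ => false := by
    funext i
    by_contra hc
    have := h i (by simpa using hc)
    omega
  obtain ⟨k, rfl⟩ : ∃ k, t = k + (m + n) := ⟨t - (m + n), by omega⟩
  rw [Function.iterate_add_apply, Function.iterate_add_apply, h0]
  exact Function.iterate_fixed zero_step k

/-- The finite mirrored TLV automaton is a finite-size linear eroder with constants
`a = 1/45` and slope `10`: for every even `L` and every nonempty `S ⊆ {1,…,L}`, if
`l` is the number of sites of the smallest interval containing `S` and `45·l ≤ L`,
then `TLV̄^t(1_S)` is identically false for every `t ≥ 10·l`. -/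
theorem TLVbar_finite_size_eroder (L : ℕ) (hLpos : 0 < L) (hLeven : Even L)
    (S : Finset ℤ) (hS : S.Nonempty) (hSsub : S ⊆ Finset.Icc 1 (L : ℤ)) :
    ∀ t : ℕ,
      45 * ((S.max' hS - S.min' hS).toNat + 1) ≤ L →
      10 * ((S.max' hS - S.min' hS).toNat + 1) ≤ t →
      (TLVbar L)^[t] (fun i => decide (i ∈ S)) = fun _ => false := by
  intro t hl ht
  have hL : (L : ℤ) % 2 = 0 := by
    obtain ⟨r, hr⟩ := hLeven
    omega
  have hbd : ∀ i, decide (i ∈ S) = true → S.min' hS ≤ i ∧ i ≤ S.max' hS := fun i hi => by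
    have hi := of_decide_eq_true hi
    exact ⟨S.min'_le i hi, S.le_max' i hi⟩
  have hp := Finset.mem_Icc.1 (hSsub (S.min'_mem hS))
  have hq := Finset.mem_Icc.1 (hSsub (S.max'_mem hS))
  have hpq : S.min' hS ≤ S.max' hS := S.min'_le _ (S.max'_mem hS)
  generalize S.min' hS = p at *
  generalize S.max' hS = q at *
  obtain ⟨l, hl0⟩ : ∃ l : ℕ, l = (q - p).toNat + 1 := ⟨_, rfl⟩
  rw [← hl0] at hl ht
  have hlq : (l : ℤ) = q - p + 1 := by omega
  have hL2 : 10 ≤ (L : ℤ) := by omega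
  obtain ⟨x, hxS⟩ : ∃ x : ℤ → Bool, x = fun i => decide (i ∈ S) := ⟨_, rfl⟩
  rw [← hxS]
  have hx : InBox x p q p q := fun i hi => by
    have := hbd i (by rw [hxS] at hi; exact hi)
    omega
  clear hbd
  obtain ⟨R, hR⟩ : ∃ R : ℕ, R = 5 * l / 2 := ⟨_, rfl⟩
  by_cases c1 : q ≤ 5 * l - 1
  · have h0 : InBox x 1 (2 * R) 1 (2 * R - 1) := fun i hi => by
      have := hx i hi
      omega
    have h1 := left1_it hL hL2 h0 R (by omega) (by omega) (by omega)
    have h1' := inBox_congr (A' := 1) (B' := 0) (C' := 1) (D' := 6 * R - 1) h1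
      (by omega) (by omega) (by omega) (by omega)
    have h2 := left2_it hL hL2 h1' (3 * R) (by push_cast; omega)
    exact empty_done h2 (by omega) (by push_cast; omega) (by omega)
  by_cases c2 : L + 2 - 5 * l ≤ p
  · have h0 : InBox x (L + 1 - (2 * R - 1)) L (L + 1 - 2 * R) L := fun i hi => by
      have := hx i hi
      omega
    have h1 := right1_it hL hL2 h0 R (by omega) (by omega) (by omega)
    have h1' := inBox_congr (A' := L + 2 - 6 * R) (B' := L) (C' := L + 1) (D' := L) h1
      (by omega) (by omega) (by omega) (by omega)
    have h2 := right2_it hL hL2 h1' (3 * R) (by push_cast; omega)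
    exact empty_done h2 (by push_cast; omega) (by omega) (by omega)
  obtain ⟨T, hT⟩ : ∃ T : ℕ, T = l / 4 := ⟨_, rfl⟩
  obtain ⟨s, hs⟩ : ∃ s : ℕ, s = T + (l + 1) / 2 := ⟨_, rfl⟩
  have h1 := bulk1_it hL hL2 hx T (by omega) (by omega) (by omega) (by omega)
  have h2 := bulk2_it hL hL2 h1 s (by omega) (by omega) (by omega) (by omega) (by omega)
  exact empty_done h2 (by omega) (by omega) (by omega)
end

section
/- (Decoding on the semi-infinite chain.) Consider the semi-infinite mirrored two-line voting automaton →TLV on sites ℕ_{≥1}, with initial configuration x(0) ⊆ ℕ_{≥1} drawn from the product Bernoulli(p) measure (each site independently occupied with probability p), and set x(t) = →TLV^t(x(0)). Let β = ln 2 / ln 35, α = 560·√p and γ = −ln α (these are the constants of the sparseness proposition for sparseness parameter k = 2Rm = 8, with TLV radius R = 4 and eroder constant m = 1). Then for every finite interval J ⊆ ℕ_{≥1} and every integer t ≥ 0, the probability that x(t) intersects J is at most (8t + |J|)·exp(−γ·t^β); this bound decays in t whenever p < p̃_c = 560^{−2} ≈ 3.2 × 10^{−6} (so that γ > 0). -/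
open MeasureTheory

/-- The semi-infinite mirrored two-line voting automaton `→TLV` on sites `ℕ_{≥1}`
(configurations modeled as `x : ℤ → Bool` vanishing on sites `< 1`): bulk TLV rules
for even `i` and odd `i ≥ 5`, together with the mirrored-boundary rules
`(→TLV x)_1 = maj[x_2, x_2, x_4]` and `(→TLV x)_3 = maj[x_4, x_1, x_2]`. -/
def sTLV (x : ℤ → Bool) : ℤ → Bool := fun i =>
  if i < 1 then false
  else if i = 1 then maj3 (x 2) (x 2) (x 4)
  else if i = 3 then maj3 (x 4) (x 1) (x 2)
  else if i % 2 = 0 then maj3 (x (i - 1)) (x (i + 2)) (x (i + 4))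
  else maj3 (x (i + 1)) (x (i - 2)) (x (i - 4))

/-- Two-of-three relation: `i` becomes occupied when `j` and `k` are. -/
def Two (i j k : ℤ) : Prop :=
  (i = 1 ∧ j = 2 ∧ k = 2) ∨
  (i = 3 ∧ ((j = 1 ∧ k = 2) ∨ (j = 1 ∧ k = 4) ∨ (j = 2 ∧ k = 4))) ∨
  (2 ≤ i ∧ i % 2 = 0 ∧
    ((j = i - 1 ∧ k = i + 2) ∨ (j = i - 1 ∧ k = i + 4) ∨ (j = i + 2 ∧ k = i + 4))) ∨
  (5 ≤ i ∧ i % 2 = 1 ∧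
    ((j = i + 1 ∧ k = i - 2) ∨ (j = i + 1 ∧ k = i - 4) ∨ (j = i - 2 ∧ k = i - 4)))

def Phi (A : Set ℤ) : Set ℤ := {i | ∃ j ∈ A, ∃ k ∈ A, Two i j k}

theorem Phi_mono {A B : Set ℤ} (h : A ⊆ B) : Phi A ⊆ Phi B := by
  rintro i ⟨j, hj, k, hk, h2⟩
  exact ⟨j, h hj, k, h hk, h2⟩

theorem Phi_iter_mono {A B : Set ℤ} (h : A ⊆ B) (t : ℕ) : Phi^[t] A ⊆ Phi^[t] B := by
  induction t with
  | zero => exact h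
  | succ t ih =>
    rw [Function.iterate_succ_apply', Function.iterate_succ_apply']
    exact Phi_mono ih

theorem Phi_empty : Phi ∅ = ∅ := by
  ext i; simp [Phi]

theorem Phi_iter_empty (t : ℕ) : Phi^[t] ∅ = ∅ := by
  induction t with
  | zero => rfl
  | succ t ih => rw [Function.iterate_succ_apply', ih, Phi_empty]

theorem Phi_iter_empty_of_le {A : Set ℤ} {s t : ℕ} (hst : s ≤ t) (h : Phi^[s] A = ∅) :
    Phi^[t] A = ∅ := by
  obtain ⟨k, rfl⟩ := Nat.exists_eq_add_of_le hst
  rw [add_comm, Function.iterate_add_apply, h, Phi_iter_empty]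

set_option maxHeartbeats 2000000 in
theorem sTLV_eq (x : ℤ → Bool) : {i | sTLV x i = true} = Phi {i | x i = true} := by
  ext i
  constructor
  · intro h
    simp only [Set.mem_ofPred_eq, sTLV, maj3] at h
    by_cases h0 : i < 1
    · simp [h0] at h
    rw [if_neg h0] at h
    by_cases h1 : i = 1
    · subst h1
      simp at h
      have h2 : x 2 = true := by tauto
      exact ⟨2, h2, 2, h2, by unfold Two; omega⟩
    rw [if_neg h1] at h
    by_cases h3 : i = 3
    · subst h3
      simp at h
      rcases h with (⟨ha, hb⟩ | ⟨ha, hb⟩) | ⟨ha, hb⟩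
      · exact ⟨1, hb, 4, ha, by unfold Two; omega⟩
      · exact ⟨2, hb, 4, ha, by unfold Two; omega⟩
      · exact ⟨1, ha, 2, hb, by unfold Two; omega⟩
    rw [if_neg h3] at h
    by_cases h4 : i % 2 = 0
    · rw [if_pos h4] at h
      simp only [Bool.or_eq_true, Bool.and_eq_true] at h
      rcases h with (⟨ha, hb⟩ | ⟨ha, hb⟩) | ⟨ha, hb⟩
      · exact ⟨_, ha, _, hb, by unfold Two; omega⟩
      · exact ⟨_, ha, _, hb, by unfold Two; omega⟩
      · exact ⟨_, ha, _, hb, by unfold Two; omega⟩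
    · rw [if_neg h4] at h
      simp only [Bool.or_eq_true, Bool.and_eq_true] at h
      rcases h with (⟨ha, hb⟩ | ⟨ha, hb⟩) | ⟨ha, hb⟩
      · exact ⟨_, ha, _, hb, by unfold Two; omega⟩
      · exact ⟨_, ha, _, hb, by unfold Two; omega⟩
      · exact ⟨_, ha, _, hb, by unfold Two; omega⟩
  · rintro ⟨j, hj, k, hk, h⟩
    change x j = true at hj
    change x k = true at hk
    unfold Two at h
    simp only [Set.mem_ofPred_eq, sTLV, maj3]
    rcases h with ⟨h1, h2, h3⟩ | ⟨h1, h⟩ | ⟨h1, h2, h⟩ | ⟨h1, h2, h⟩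
    · subst h1 h2
      simp [hj]
    · subst h1
      rcases h with ⟨rfl, rfl⟩ | ⟨rfl, rfl⟩ | ⟨rfl, rfl⟩ <;> simp [hj, hk]
    · rw [if_neg (by omega), if_neg (by omega), if_neg (by omega), if_pos h2]
      rcases h with ⟨rfl, rfl⟩ | ⟨rfl, rfl⟩ | ⟨rfl, rfl⟩ <;> simp [hj, hk]
    · rw [if_neg (by omega), if_neg (by omega), if_neg (by omega), if_neg (by omega)]
      rcases h with ⟨rfl, rfl⟩ | ⟨rfl, rfl⟩ | ⟨rfl, rfl⟩ <;> simp [hj, hk]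

theorem sTLV_iter_eq (x : ℤ → Bool) (t : ℕ) :
    {i | sTLV^[t] x i = true} = Phi^[t] {i | x i = true} := by
  induction t with
  | zero => rfl
  | succ t ih => rw [Function.iterate_succ_apply', Function.iterate_succ_apply', sTLV_eq, ih]

theorem Phi_pos (A : Set ℤ) : Phi A = Phi {i | 1 ≤ i ∧ i ∈ A} := by
  apply Set.Subset.antisymm
  · rintro i ⟨j, hj, k, hk, h⟩
    refine ⟨j, ⟨?_, hj⟩, k, ⟨?_, hk⟩, h⟩ <;> unfold Two at h <;> omega
  · exact Phi_mono (fun i hi => hi.2)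

theorem Phi_cone (B : Set ℤ) (t : ℕ) :
    ∀ i ∈ Phi^[t] B, ∃ b ∈ B, i - 2 * t ≤ b ∧ b ≤ i + 2 * t := by
  induction t with
  | zero => intro i hi; exact ⟨i, hi, by simp, by simp⟩
  | succ t ih =>
    intro i hi
    rw [Function.iterate_succ_apply'] at hi
    obtain ⟨j, hj, k, hk, h⟩ := hi
    obtain ⟨b, hb, h1, h2⟩ := ih j hj
    obtain ⟨c, hc, h3, h4⟩ := ih k hk
    by_cases hjj : i - 2 ≤ j ∧ j ≤ i + 2
    · exact ⟨b, hb, by push_cast; omega, by push_cast; omega⟩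
    · have : i - 2 ≤ k ∧ k ≤ i + 2 := by unfold Two at h; omega
      exact ⟨c, hc, by push_cast; omega, by push_cast; omega⟩

theorem Phi_family (𝒞 : Set (Set ℤ)) (T : ℕ)
    (hsep : ∀ S ∈ 𝒞, ∀ S' ∈ 𝒞, S ≠ S' → ∀ a ∈ S, ∀ b ∈ S',
      a + (4 * T + 1) < b ∨ b + (4 * T + 1) < a) (t : ℕ) (ht : t ≤ T) :
    ∀ i ∈ Phi^[t] (⋃₀ 𝒞), ∃ S ∈ 𝒞, i ∈ Phi^[t] S := by
  induction t with
  | zero => intro i hi; exact hi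
  | succ t ih =>
    intro i hi
    rw [Function.iterate_succ_apply'] at hi
    obtain ⟨j, hj, k, hk, h⟩ := hi
    obtain ⟨S, hS, hjS⟩ := ih (by omega) j hj
    obtain ⟨S', hS', hkS⟩ := ih (by omega) k hk
    obtain ⟨a, ha, h1, h2⟩ := Phi_cone S t j hjS
    obtain ⟨b, hb, h3, h4⟩ := Phi_cone S' t k hkS
    by_cases hne : S = S'
    · subst hne
      refine ⟨S, hS, ?_⟩
      rw [Function.iterate_succ_apply']
      exact ⟨j, hjS, k, hkS, h⟩
    · exfalso
      have := hsep S hS S' hS' hne a ha b hb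
      have : j - 5 ≤ k ∧ k ≤ j + 5 := by unfold Two at h; omega
      omega

/-! Erosion of islands. -/

theorem erode_boundary (A : Set ℤ) (r : ℕ) (hA : ∀ i ∈ A, 1 ≤ i ∧ i ≤ r) :
    Phi^[r + r / 2] A = ∅ := by
  have h1 : ∀ t : ℕ, ∀ i ∈ Phi^[t] A, 1 ≤ i ∧ (i % 2 = 0 → i ≤ r - 2 * t) ∧
      (i % 2 = 1 → i ≤ r + 2 * t) := by
    intro t
    induction t with
    | zero => intro i hi; have := hA i hi; simp; omega
    | succ t ih =>
      intro i hi
      rw [Function.iterate_succ_apply'] at hi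
      obtain ⟨j, hj, k, hk, h⟩ := hi
      have h1 := ih j hj
      have h2 := ih k hk
      unfold Two at h
      push_cast
      omega
  have h2 : ∀ s : ℕ, ∀ i ∈ Phi^[s + r / 2] A, i % 2 = 1 ∧ 1 + 4 * s ≤ i ∧
      i ≤ r + 2 * (r / 2 : ℕ) + 2 * s := by
    intro s
    induction s with
    | zero =>
      intro i hi
      have := h1 (r / 2) i (by simpa using hi)
      push_cast at *
      omega
    | succ s ih =>
      intro i hi
      rw [show s + 1 + r / 2 = (s + r / 2) + 1 by omega, Function.iterate_succ_apply'] at hi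
      obtain ⟨j, hj, k, hk, h⟩ := hi
      have h1 := ih j hj
      have h2 := ih k hk
      unfold Two at h
      push_cast at *
      omega
  ext i
  simp only [Set.mem_empty_iff_false, iff_false]
  intro hi
  have := h2 r i hi
  push_cast at *
  omega

theorem erode_bulk (A : Set ℤ) (l : ℤ) (u : ℕ) (hl : 6 * u + 5 ≤ l)
    (hA : ∀ i ∈ A, l ≤ i ∧ i ≤ l + 4 * u) :
    Phi^[2 * u + 1 + u] A = ∅ := by
  have h1 : ∀ t : ℕ, t ≤ u → ∀ i ∈ Phi^[t] A,
      (i % 2 = 0 → l - 2 * t ≤ i ∧ i ≤ l + 4 * u - 2 * t) ∧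
      (i % 2 = 1 → l + 2 * t ≤ i ∧ i ≤ l + 4 * u + 2 * t) := by
    intro t
    induction t with
    | zero => intro _ i hi; have := hA i hi; simp; omega
    | succ t ih =>
      intro ht i hi
      rw [Function.iterate_succ_apply'] at hi
      obtain ⟨j, hj, k, hk, h⟩ := hi
      have h1 := ih (by omega) j hj
      have h2 := ih (by omega) k hk
      unfold Two at h
      push_cast
      omega
  have h2 : ∀ s : ℕ, s ≤ 2 * u + 1 → ∀ i ∈ Phi^[s + u] A,
      (i % 2 = 0 → l - 2 * u - 2 * s ≤ i ∧ i ≤ l + 2 * u - 4 * s) ∧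
      (i % 2 = 1 → l + 2 * u + 4 * s ≤ i ∧ i ≤ l + 6 * u + 2 * s) := by
    intro s
    induction s with
    | zero =>
      intro _ i hi
      have := h1 u le_rfl i (by simpa using hi)
      push_cast at *
      omega
    | succ s ih =>
      intro hs i hi
      rw [show s + 1 + u = (s + u) + 1 by omega, Function.iterate_succ_apply'] at hi
      obtain ⟨j, hj, k, hk, h⟩ := hi
      have h1 := ih (by omega) j hj
      have h2 := ih (by omega) k hk
      unfold Two at h
      push_cast at *
      omega
  ext i
  simp only [Set.mem_empty_iff_false, iff_false]
  intro hi
  have := h2 (2 * u + 1) le_rfl i hi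
  push_cast at *
  omega

theorem erode (A : Set ℤ) (l r : ℤ) (u : ℕ) (hl : 1 ≤ l) (hr : r - l ≤ 4 * u)
    (hA : ∀ i ∈ A, l ≤ i ∧ i ≤ r) : Phi^[15 * u + 10] A = ∅ := by
  by_cases h : 6 * u + 5 ≤ l
  · refine Phi_iter_empty_of_le (by omega) (erode_bulk A l u h ?_)
    intro i hi
    have := hA i hi
    omega
  · refine Phi_iter_empty_of_le (s := (10 * u + 4) + (10 * u + 4) / 2) (by omega)
      (erode_boundary A _ ?_)
    intro i hi
    have := hA i hi
    push_cast
    omega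

/-! Multiscale sparseness. The scale is `ρ_n = 2 * uu n`. -/

def uu : ℕ → ℕ
  | 0 => 0
  | n + 1 => 33 * uu n + 21

theorem uu_eq (n : ℕ) : 32 * uu n + 21 = 21 * 33 ^ n := by
  induction n with
  | zero => rfl
  | succ n ih => rw [uu, pow_succ]; omega

def IsIsland (A : Set ℤ) (u : ℕ) (l r : ℤ) : Prop :=
  1 ≤ l ∧ r - l ≤ 4 * u ∧
    ∀ y ∈ A, l - (60 * u + 42) ≤ y → y ≤ r + (60 * u + 42) → l ≤ y ∧ y ≤ r

def Lev (X : Set ℤ) : ℕ → Set ℤ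
  | 0 => X
  | n + 1 => {x | x ∈ Lev X n ∧ ¬ ∃ l r, l ≤ x ∧ x ≤ r ∧ IsIsland (Lev X n) (uu n) l r}

theorem Lev_subset (X : Set ℤ) (n : ℕ) : Lev X n ⊆ X := by
  induction n with
  | zero => exact subset_rfl
  | succ n ih => exact fun x hx => ih hx.1

theorem Lev_step (X : Set ℤ) (n : ℕ) :
    Phi^[15 * uu n + 10] (Lev X n) = Phi^[15 * uu n + 10] (Lev X (n + 1)) := by
  apply Set.Subset.antisymm
  swap
  · exact Phi_iter_mono (fun x hx => hx.1) _
  set A := Lev X n with hAdef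
  set B := Lev X (n + 1) with hBdef
  have hB : ∀ x, x ∈ B ↔ x ∈ A ∧ ¬ ∃ l r, l ≤ x ∧ x ≤ r ∧ IsIsland A (uu n) l r := fun x => Iff.rfl
  let 𝒞 : Set (Set ℤ) := {S | S = B ∨ ∃ l r, IsIsland A (uu n) l r ∧ S = {y | y ∈ A ∧ l ≤ y ∧ y ≤ r}}
  have hU : A ⊆ ⋃₀ 𝒞 := by
    intro x hx
    by_cases h : x ∈ B
    · exact ⟨B, Or.inl rfl, h⟩
    · have h' : ∃ l r, l ≤ x ∧ x ≤ r ∧ IsIsland A (uu n) l r := by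
        by_contra hc
        exact h ((hB x).2 ⟨hx, hc⟩)
      obtain ⟨l, r, h1, h2, h3⟩ := h'
      exact ⟨_, Or.inr ⟨l, r, h3, rfl⟩, hx, h1, h2⟩
  have key1 : ∀ l r, IsIsland A (uu n) l r → ∀ a ∈ A, l ≤ a → a ≤ r → ∀ b ∈ B,
      a + (60 * uu n + 42) < b ∨ b + (60 * uu n + 42) < a := by
    intro l r hI a ha h1 h2 b hb
    by_contra hc
    have hb' := (hB b).1 hb
    have := hI.2.2 b hb'.1 (by omega) (by omega)
    exact hb'.2 ⟨l, r, this.1, this.2, hI⟩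
  have key2 : ∀ l r l' r', IsIsland A (uu n) l r → IsIsland A (uu n) l' r' →
      ∀ a ∈ A, l ≤ a → a ≤ r → ∀ b ∈ A, l' ≤ b → b ≤ r' →
      ¬ (a + (60 * uu n + 42) < b ∨ b + (60 * uu n + 42) < a) →
      ∀ y ∈ A, l' ≤ y → y ≤ r' → l ≤ y ∧ y ≤ r := by
    intro l r l' r' hI hI' a ha h1 h2 b hb h3 h4 hc y hy h5 h6
    have h7 := hI.2.2 b hb (by omega) (by omega)
    have h8 := hI'.2.1
    exact hI.2.2 y hy (by omega) (by omega)
  have hsep : ∀ S ∈ 𝒞, ∀ S' ∈ 𝒞, S ≠ S' → ∀ a ∈ S, ∀ b ∈ S',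
      a + (4 * ((15 * uu n + 10 : ℕ) : ℤ) + 1) < b ∨ b + (4 * ((15 * uu n + 10 : ℕ) : ℤ) + 1) < a := by
    rintro S (rfl | ⟨l, r, hI, rfl⟩) S' (rfl | ⟨l', r', hI', rfl⟩) hne a ha b hb
    · exact absurd rfl hne
    · have := key1 l' r' hI' b hb.1 hb.2.1 hb.2.2 a ha
      push_cast; omega
    · have := key1 l r hI a ha.1 ha.2.1 ha.2.2 b hb
      push_cast; omega
    · by_cases hc : a + (60 * (uu n : ℤ) + 42) < b ∨ b + (60 * (uu n : ℤ) + 42) < a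
      · push_cast; omega
      · exfalso
        apply hne
        have e1 := key2 l r l' r' hI hI' a ha.1 ha.2.1 ha.2.2 b hb.1 hb.2.1 hb.2.2 hc
        have e2 := key2 l' r' l r hI' hI b hb.1 hb.2.1 hb.2.2 a ha.1 ha.2.1 ha.2.2 (by omega)
        ext y
        constructor
        · rintro ⟨h1, h2, h3⟩; exact ⟨h1, e2 y h1 h2 h3⟩
        · rintro ⟨h1, h2, h3⟩; exact ⟨h1, e1 y h1 h2 h3⟩
  intro i hi
  obtain ⟨S, hS, hiS⟩ := Phi_family 𝒞 _ hsep _ le_rfl i (Phi_iter_mono hU _ hi)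
  rcases hS with rfl | ⟨l, r, hI, rfl⟩
  · exact hiS
  · rw [erode _ l r (uu n) hI.1 hI.2.1 (fun i hi => hi.2)] at hiS
    exact absurd hiS (Set.notMem_empty _)

theorem Lev_iter (X : Set ℤ) (n t : ℕ) (h : ∀ m < n, 15 * uu m + 10 ≤ t) :
    Phi^[t] X = Phi^[t] (Lev X n) := by
  induction n with
  | zero => rfl
  | succ n ih =>
    rw [ih (fun m hm => h m (by omega))]
    obtain ⟨k, hk⟩ := Nat.exists_eq_add_of_le (h n (by omega))
    rw [hk, add_comm, Function.iterate_add_apply _ k, Function.iterate_add_apply _ k, Lev_step]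

/-- Candidate pairs. -/
noncomputable def Prs (n : ℕ) (x : ℤ) : Finset (ℤ × ℤ) :=
  (({x} : Finset ℤ) ×ˢ Finset.Icc (x - (64 * uu n + 42)) (x + (64 * uu n + 42)) ∪
    Finset.Icc (x - 4 * uu n) (x + 4 * uu n) ×ˢ Finset.Icc (x - 4 * uu n) (x + 4 * uu n)).filter
    (fun q => q.1 + 4 * uu n < q.2 ∨ q.2 + 4 * uu n < q.1)

theorem Prs_card (n : ℕ) (x : ℤ) : (Prs n x).card ≤ 86 * 1089 ^ n := by
  have h1 : (Prs n x).card ≤ (128 * uu n + 85) + (8 * uu n + 1) * (8 * uu n + 1) := by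
    refine (Finset.card_filter_le _ _).trans ((Finset.card_union_le _ _).trans ?_)
    rw [Finset.card_product, Finset.card_product, Finset.card_singleton, Int.card_Icc, Int.card_Icc]
    apply Nat.add_le_add
    · omega
    · apply Nat.mul_le_mul <;> omega
  refine h1.trans ?_
  have h2 := uu_eq n
  have h3 : (1089 : ℕ) ^ n = 33 ^ n * 33 ^ n := by rw [← mul_pow]; norm_num
  rw [h3]
  have h4 : 1 ≤ 33 ^ n := Nat.one_le_pow _ _ (by norm_num)
  generalize 33 ^ n = w at *
  generalize uu n = u at *
  have h5 : u + 1 ≤ w := by omega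
  nlinarith

theorem Lev_pair (X : Set ℤ) (hX : ∀ x ∈ X, 1 ≤ x) (n : ℕ) (x : ℤ) (hx : x ∈ Lev X (n + 1)) :
    ∃ q ∈ Prs n x, q.1 ∈ Lev X n ∧ q.2 ∈ Lev X n := by
  by_contra hc
  push Not at hc
  obtain ⟨hxA, hno⟩ := hx
  classical
  have hnear : ∀ y ∈ Lev X n, x - (64 * uu n + 42) ≤ y → y ≤ x + (64 * uu n + 42) →
      x - 4 * uu n ≤ y ∧ y ≤ x + 4 * uu n := by
    intro y hy h1 h2
    by_contra h3
    refine hc (x, y) ?_ hxA hy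
    simp only [Prs, Finset.mem_filter, Finset.mem_union, Finset.mem_product, Finset.mem_singleton,
      Finset.mem_Icc]
    refine ⟨Or.inl ⟨trivial, h1, h2⟩, ?_⟩
    omega
  let C : Finset ℤ := (Finset.Icc (x - 4 * (uu n : ℤ)) (x + 4 * uu n)).filter (fun y => y ∈ Lev X n)
  have hC : ∀ y, y ∈ C ↔ (x - 4 * uu n ≤ y ∧ y ≤ x + 4 * uu n) ∧ y ∈ Lev X n := by
    intro y; simp [C]
  have hxC : x ∈ C := (hC x).2 ⟨⟨by omega, by omega⟩, hxA⟩
  have hne : C.Nonempty := ⟨x, hxC⟩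
  have hl := (hC _).1 (C.min'_mem hne)
  have hr := (hC _).1 (C.max'_mem hne)
  have hle : ∀ y ∈ C, C.min' hne ≤ y ∧ y ≤ C.max' hne :=
    fun y hy => ⟨C.min'_le y hy, C.le_max' y hy⟩
  generalize C.min' hne = l at *
  generalize C.max' hne = r at *
  have hlr : r - l ≤ 4 * uu n := by
    by_contra h3
    refine hc (l, r) ?_ hl.2 hr.2
    simp only [Prs, Finset.mem_filter, Finset.mem_union, Finset.mem_product, Finset.mem_singleton,
      Finset.mem_Icc]
    exact ⟨Or.inr ⟨hl.1, hr.1⟩, by omega⟩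
  have hxx := hle x hxC
  refine hno ⟨l, r, hxx.1, hxx.2, hX l (Lev_subset X n hl.2), hlr, ?_⟩
  intro y hy h1 h2
  exact hle y ((hC y).2 ⟨hnear y hy (by omega) (by omega), hy⟩)

/-- Witness sets. -/
noncomputable def Wit : ℕ → ℤ → Finset (Finset ℤ)
  | 0, x => {{x}}
  | n + 1, x => (Prs n x).biUnion (fun q => (Wit n q.1 ×ˢ Wit n q.2).image (fun s => s.1 ∪ s.2))

theorem Wit_card (n : ℕ) : ∀ x, (Wit n x).card * (93654 * 1089 ^ n) ≤ 313600 ^ (2 ^ n) := by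
  have : ∃ N : ℕ, (∀ x, (Wit n x).card ≤ N) ∧ N * (93654 * 1089 ^ n) ≤ 313600 ^ (2 ^ n) := by
    induction n with
    | zero => exact ⟨1, fun x => by simp [Wit], by norm_num⟩
    | succ n ih =>
      obtain ⟨N, h1, h2⟩ := ih
      refine ⟨86 * 1089 ^ n * (N * N), ?_, ?_⟩
      · intro x
        rw [Wit]
        refine (Finset.card_biUnion_le_card_mul _ _ (N * N) ?_).trans
          (Nat.mul_le_mul_right _ (Prs_card n x))
        intro q _
        refine Finset.card_image_le.trans ?_
        rw [Finset.card_product]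
        exact Nat.mul_le_mul (h1 _) (h1 _)
      · rw [pow_succ 2 n, pow_mul, sq]
        refine le_trans (le_of_eq ?_) (Nat.mul_le_mul h2 h2)
        rw [pow_succ]
        ring
  obtain ⟨N, h1, h2⟩ := this
  exact fun x => (Nat.mul_le_mul_right _ (h1 x)).trans h2

theorem Wit_prop (n : ℕ) : ∀ x, ∀ S ∈ Wit n x, S.card = 2 ^ n ∧
    ∀ y ∈ S, x - 2 * uu n ≤ y ∧ y ≤ x + 2 * uu n := by
  induction n with
  | zero => intro x S hS; simp [Wit] at hS; subst hS; simp [uu]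
  | succ n ih =>
    intro x S hS
    simp only [Wit, Finset.mem_biUnion, Finset.mem_image, Finset.mem_product] at hS
    obtain ⟨q, hq, ⟨s1, s2⟩, ⟨h1, h2⟩, rfl⟩ := hS
    simp only [Prs, Finset.mem_filter, Finset.mem_union, Finset.mem_product, Finset.mem_singleton,
      Finset.mem_Icc] at hq
    obtain ⟨c1, b1⟩ := ih _ _ h1
    obtain ⟨c2, b2⟩ := ih _ _ h2
    constructor
    · rw [Finset.card_union_of_disjoint, c1, c2, pow_succ]
      · ring
      · rw [Finset.disjoint_left]
        intro y hy1 hy2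
        have := b1 y hy1
        have := b2 y hy2
        omega
    · intro y hy
      simp only [uu]
      rcases Finset.mem_union.1 hy with hy | hy
      · have := b1 y hy
        push_cast
        omega
      · have := b2 y hy
        push_cast
        omega

theorem Lev_wit (X : Set ℤ) (hX : ∀ x ∈ X, 1 ≤ x) (n : ℕ) :
    ∀ x ∈ Lev X n, ∃ S ∈ Wit n x, ∀ y ∈ S, y ∈ X := by
  induction n with
  | zero =>
    intro x hx
    exact ⟨{x}, by simp [Wit], by intro y hy; rw [Finset.mem_singleton.1 hy]; exact hx⟩
  | succ n ih =>
    intro x hx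
    obtain ⟨q, hq, h1, h2⟩ := Lev_pair X hX n x hx
    obtain ⟨s1, hs1, hs1'⟩ := ih _ h1
    obtain ⟨s2, hs2, hs2'⟩ := ih _ h2
    refine ⟨s1 ∪ s2, ?_, ?_⟩
    · simp only [Wit, Finset.mem_biUnion, Finset.mem_image, Finset.mem_product]
      exact ⟨q, hq, (s1, s2), ⟨hs1, hs2⟩, rfl⟩
    · intro y hy
      rcases Finset.mem_union.1 hy with hy | hy
      · exact hs1' y hy
      · exact hs2' y hy

theorem scale_exists (t : ℕ) : ∃ n, (∀ m < n, 15 * uu m + 10 ≤ t) ∧ t ≤ 35 ^ (n + 1) := by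
  have hex : ∃ n, t < 15 * uu n + 10 := by
    refine ⟨t, ?_⟩
    have h1 := uu_eq t
    have h2 : t < 33 ^ t := Nat.lt_pow_self (by norm_num)
    omega
  classical
  refine ⟨Nat.find hex, fun m hm => not_lt.1 (Nat.find_min hex hm), ?_⟩
  have h := Nat.find_spec hex
  generalize Nat.find hex = n at *
  have h1 := uu_eq n
  have h2 : 33 ^ n ≤ 35 ^ n := Nat.pow_le_pow_left (by norm_num) n
  rw [pow_succ]
  omega

/-- Decoding on the semi-infinite chain: let the initial configuration of `→TLV` be
drawn from the product Bernoulli(`p`) measure on the sites `i ≥ 1` (characterized by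
its cylinder probabilities, with sites `i < 1` empty almost surely). With
`β = ln 2 / ln 35`, `α = 560·√p` and `γ = -ln α` (the constants of the sparseness
proposition for sparseness parameter `k = 2Rm = 8`, radius `R = 4`, eroder constant
`m = 1`), for every finite interval `J = [a,b] ⊆ ℕ_{≥1}` and every `t ≥ 0`, the
probability that `→TLV^t(x)` intersects `J` is at most `(8t + |J|)·exp(-γ·t^β)`. -/
theorem sTLV_decoding_bound (p : ℝ) (hp0 : 0 ≤ p) (hp1 : p ≤ 1)
    (μ : Measure (ℤ → Bool)) [IsProbabilityMeasure μ]
    (hcyl : ∀ S : Finset ℤ, (∀ i ∈ S, 1 ≤ i) → ∀ ε : ℤ → Bool,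
      μ {x | ∀ i ∈ S, x i = ε i}
        = ∏ i ∈ S, ENNReal.ofReal (if ε i then p else 1 - p))
    (hempty : ∀ i : ℤ, i < 1 → μ {x | x i = false} = 1) :
    ∀ (a b : ℤ), 1 ≤ a → a ≤ b → ∀ t : ℕ,
      μ {x : ℤ → Bool | ∃ i, a ≤ i ∧ i ≤ b ∧ sTLV^[t] x i = true}
        ≤ ENNReal.ofReal
            ((8 * (t : ℝ) + ((b : ℝ) - (a : ℝ) + 1))
              * Real.exp (-((-Real.log (560 * Real.sqrt p))
                  * (t : ℝ) ^ (Real.log 2 / Real.log 35)))) := by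
  intro a b ha hab t
  have hJ : (1 : ℝ) ≤ (b : ℝ) - a + 1 := by
    have : (a : ℝ) ≤ b := by exact_mod_cast hab
    linarith
  have ht0 : (0 : ℝ) ≤ t := Nat.cast_nonneg t
  set β := Real.log 2 / Real.log 35 with hβ
  have hβ0 : 0 < β := div_pos (Real.log_pos (by norm_num)) (Real.log_pos (by norm_num))
  -- trivial case: the exponential is at least one
  have triv : Real.log (560 * Real.sqrt p) * (t : ℝ) ^ β ≥ 0 →
      μ {x : ℤ → Bool | ∃ i, a ≤ i ∧ i ≤ b ∧ sTLV^[t] x i = true}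
        ≤ ENNReal.ofReal
            ((8 * (t : ℝ) + ((b : ℝ) - (a : ℝ) + 1))
              * Real.exp (-((-Real.log (560 * Real.sqrt p)) * (t : ℝ) ^ β))) := by
    intro h
    refine prob_le_one.trans ?_
    rw [← ENNReal.ofReal_one]
    apply ENNReal.ofReal_le_ofReal
    have : 1 ≤ Real.exp (-((-Real.log (560 * Real.sqrt p)) * (t : ℝ) ^ β)) := by
      apply Real.one_le_exp
      linarith
    nlinarith
  rcases Nat.eq_zero_or_pos t with h0 | htpos
  · apply triv
    subst h0
    simp [Real.zero_rpow hβ0.ne']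
  rcases le_or_gt 0 (Real.log (560 * Real.sqrt p)) with hlog | hlog
  · exact triv (mul_nonneg hlog (Real.rpow_nonneg ht0 _))
  clear triv
  have hα0 : 0 < 560 * Real.sqrt p := by
    rcases (by positivity : 0 ≤ 560 * Real.sqrt p).eq_or_lt with h | h
    · rw [← h] at hlog; simp at hlog
    · exact h
  obtain ⟨n, hn1, hn2⟩ := scale_exists t
  -- exponent comparison
  have hpow : (t : ℝ) ^ β ≤ 2 ^ (n + 1) := by
    have h1 : (t : ℝ) ≤ (35 : ℝ) ^ (n + 1) := by exact_mod_cast hn2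
    have h2 : (35 : ℝ) ^ β = 2 := by
      rw [Real.rpow_def_of_pos (by norm_num), hβ, mul_div_cancel₀ _
        (Real.log_pos (by norm_num)).ne', Real.exp_log (by norm_num)]
    calc (t : ℝ) ^ β ≤ ((35 : ℝ) ^ (n + 1)) ^ β := Real.rpow_le_rpow ht0 h1 hβ0.le
      _ = ((35 : ℝ) ^ β) ^ (n + 1) := by
        rw [← Real.rpow_natCast, ← Real.rpow_natCast, ← Real.rpow_mul (by norm_num),
          ← Real.rpow_mul (by norm_num), mul_comm]
      _ = 2 ^ (n + 1) := by rw [h2]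
  have hexp : (313600 * p) ^ (2 ^ n) ≤
      Real.exp (-((-Real.log (560 * Real.sqrt p)) * (t : ℝ) ^ β)) := by
    have h1 : 313600 * p = (560 * Real.sqrt p) ^ 2 := by
      rw [mul_pow, Real.sq_sqrt hp0]; norm_num
    rw [h1, ← pow_mul, ← Real.exp_log (pow_pos hα0 _), Real.log_pow]
    apply Real.exp_le_exp.2
    have h2 : ((2 * 2 ^ n : ℕ) : ℝ) = 2 ^ (n + 1) := by push_cast; ring
    rw [h2]
    nlinarith
  -- the covering of the event
  let I : Finset ℤ := Finset.Icc (a - 2 * t) (b + 2 * t)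
  have hcov : {x : ℤ → Bool | ∃ i, a ≤ i ∧ i ≤ b ∧ sTLV^[t] x i = true} ⊆
      ⋃ i ∈ I, ⋃ S ∈ (Wit n i).filter (fun S => ∀ j ∈ S, 1 ≤ j),
        {x : ℤ → Bool | ∀ j ∈ S, x j = (fun _ => true) j} := by
    rintro x ⟨i, hai, hib, hi⟩
    have hi' : i ∈ Phi^[t] {i | x i = true} := by rw [← sTLV_iter_eq]; exact hi
    obtain ⟨s, rfl⟩ := Nat.exists_eq_add_of_le' htpos
    set X : Set ℤ := {i | 1 ≤ i ∧ i ∈ {i | x i = true}} with hXdef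
    have hi2 : i ∈ Phi^[s + 1] X := by
      rw [Function.iterate_succ_apply] at hi' ⊢
      rw [← Phi_pos]; exact hi'
    rw [Lev_iter X n _ hn1] at hi2
    obtain ⟨c, hc, hc1, hc2⟩ := Phi_cone _ _ i hi2
    obtain ⟨S, hS, hSX⟩ := Lev_wit X (fun y hy => hy.1) n c hc
    simp only [Set.mem_iUnion]
    refine ⟨c, Finset.mem_Icc.2 ⟨by omega, by omega⟩, S,
      Finset.mem_filter.2 ⟨hS, fun j hj => (hSX j hj).1⟩, fun j hj => (hSX j hj).2⟩
  have hp' : (0 : ℝ) ≤ p ^ (2 ^ n) := pow_nonneg hp0 _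
  have hpt : ∀ i ∈ I, μ (⋃ S ∈ (Wit n i).filter (fun S => ∀ j ∈ S, 1 ≤ j),
        {x : ℤ → Bool | ∀ j ∈ S, x j = (fun _ => true) j}) ≤
        ENNReal.ofReal ((313600 * p) ^ (2 ^ n)) := by
    intro i _
    refine (measure_biUnion_finset_le _ _).trans ?_
    have h1 : ∀ S ∈ (Wit n i).filter (fun S => ∀ j ∈ S, 1 ≤ j),
        μ {x : ℤ → Bool | ∀ j ∈ S, x j = (fun _ => true) j} ≤ ENNReal.ofReal (p ^ (2 ^ n)) := by
      intro S hS
      obtain ⟨hS1, hS2⟩ := Finset.mem_filter.1 hS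
      rw [hcyl S hS2 (fun _ => true)]
      simp [(Wit_prop n i S hS1).1, ENNReal.ofReal_pow hp0]
    refine (Finset.sum_le_card_nsmul _ _ _ h1).trans ?_
    rw [nsmul_eq_mul, ← ENNReal.ofReal_natCast, ← ENNReal.ofReal_mul (Nat.cast_nonneg _)]
    apply ENNReal.ofReal_le_ofReal
    rw [mul_pow]
    apply mul_le_mul_of_nonneg_right _ hp'
    have h2 : ((Wit n i).filter (fun S => ∀ j ∈ S, 1 ≤ j)).card ≤ 313600 ^ (2 ^ n) := by
      refine (Finset.card_filter_le _ _).trans (le_trans ?_ (Wit_card n i))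
      exact Nat.le_mul_of_pos_right _ (by positivity)
    exact_mod_cast h2
  refine (measure_mono hcov).trans ((measure_biUnion_finset_le _ _).trans
    ((Finset.sum_le_card_nsmul _ _ _ hpt).trans ?_))
  rw [nsmul_eq_mul, ← ENNReal.ofReal_natCast, ← ENNReal.ofReal_mul (Nat.cast_nonneg _)]
  apply ENNReal.ofReal_le_ofReal
  apply mul_le_mul _ hexp (by positivity) (by positivity)
  have hcard : ((I.card : ℕ) : ℤ) = b + 2 * t + 1 - (a - 2 * t) := by
    simp only [I, Int.card_Icc]
    omega
  have hcard' : ((I.card : ℕ) : ℝ) = b + 2 * t + 1 - (a - 2 * t) := by exact_mod_cast hcard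
  rw [hcard']
  linarith
end

section
/- (Decoding on the finite chain.) Let L be an even positive integer and consider the finite mirrored two-line voting automaton TLV̄ on {1,…,L} with initial configuration x(0) ⊆ {1,…,L} drawn from the product Bernoulli(p) measure, and set x(t) = TLV̄^t(x(0)). Let β = ln 2 / ln 35, α = 560·√p, γ = −ln α, and define {t} = min(t, ⌊L/8⌋). Then for every integer t ≥ 0, the probability that x(t) is nonempty is at most (16·{t} + L)·exp(−γ·{t}^β); this bound is nontrivial whenever p < p̃_c = 560^{−2} (so that γ > 0). -/
-- The probability, w.r.t. the product Bernoulli(`p`) measure on initial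
-- configurations `E ⊆ {1,…,L}`, that the evolved state `TLV̄^t(1_E)` is nonempty.
open Classical in
noncomputable def TLVbarNonemptyProb (p : ℝ) (L : ℕ) (t : ℕ) : ℝ :=
  ∑ E ∈ (Finset.Icc (1 : ℤ) (L : ℤ)).powerset,
    if ∃ i : ℤ, (TLVbar L)^[t] (fun j => decide (j ∈ E)) i = true then
      p ^ E.card * (1 - p) ^ (L - E.card)
    else 0

/-- unfolding coordinate -/
def psi (i : ℤ) : ℤ := if i % 2 = 0 then 1 - i else i

lemma maj3_iff (a b c : Bool) : maj3 a b c = true ↔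
    (a = true ∧ b = true) ∨ (a = true ∧ c = true) ∨ (b = true ∧ c = true) := by
  cases a <;> cases b <;> cases c <;> simp [maj3]

lemma tlv_inv_step (L : ℕ) (hL : 8 ≤ L) (hev : Even L) (x : ℤ → Bool) (A B : ℤ → Prop)
    (hx : ∀ i, x i = true → A (psi i))
    (hb : ∀ z, A z → -(L:ℤ) + 2 ≤ z ∧ z ≤ L - 2)
    (hs : ∀ z, z % 2 = 1 → ((A (-z) ∧ A (z-2)) ∨ (A (-z) ∧ A (z-4)) ∨ (A (z-2) ∧ A (z-4))) → B z) :
    ∀ i, TLVbar L x i = true → B (psi i) := by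
  intro i hi
  obtain ⟨n, hn⟩ := hev
  unfold TLVbar at hi
  have key : ∀ j z, x j = true → psi j = z → A z := fun j z h1 h2 => h2 ▸ hx j h1
  have bad : ∀ j, x j = true → psi j = 1 - (L:ℤ) ∨ psi j = (L:ℤ) - 1 → False := by
    intro j h1 h2
    have := hb _ (hx j h1)
    omega
  have hodd : psi i % 2 = 1 := by unfold psi; split_ifs <;> omega
  apply hs _ hodd
  split_ifs at hi with h1 h2 h3 h4 h5 h6
  · subst h2
    rw [maj3_iff] at hi
    have e : psi 1 = 1 := by decide
    rw [e]
    rcases hi with ⟨a, b⟩ | ⟨a, b⟩ | ⟨a, b⟩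
    · exact Or.inl ⟨key 2 _ a (by decide), key 2 _ a (by decide)⟩
    · exact Or.inr (Or.inl ⟨key 2 _ a (by decide), key 4 _ b (by decide)⟩)
    · exact Or.inr (Or.inl ⟨key 2 _ a (by decide), key 4 _ b (by decide)⟩)
  · subst h3
    rw [maj3_iff] at hi
    have e : psi 3 = 3 := by decide
    rw [e]
    rcases hi with ⟨a, b⟩ | ⟨a, b⟩ | ⟨a, b⟩
    · exact Or.inl ⟨key 4 _ a (by decide), key 1 _ b (by decide)⟩
    · exact Or.inr (Or.inl ⟨key 4 _ a (by decide), key 2 _ b (by decide)⟩)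
    · exact Or.inr (Or.inr ⟨key 1 _ a (by decide), key 2 _ b (by decide)⟩)
  · exfalso
    rw [maj3_iff] at hi
    have : x ((L:ℤ)-1) = true := by tauto
    apply bad _ this
    unfold psi; split_ifs <;> omega
  · exfalso
    rw [maj3_iff] at hi
    have : x ((L:ℤ)-1) = true ∨ x (L:ℤ) = true := by tauto
    rcases this with this | this
    · apply bad _ this
      unfold psi; split_ifs <;> omega
    · apply bad _ this
      unfold psi; split_ifs <;> omega
  · rw [maj3_iff] at hi
    have p1 : psi (i-1) = - psi i := by unfold psi; split_ifs <;> omega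
    have p2 : psi (i+2) = psi i - 2 := by unfold psi; split_ifs <;> omega
    have p3 : psi (i+4) = psi i - 4 := by unfold psi; split_ifs <;> omega
    rw [← p1, ← p2, ← p3]
    rcases hi with ⟨a, b⟩ | ⟨a, b⟩ | ⟨a, b⟩
    · exact Or.inl ⟨hx _ a, hx _ b⟩
    · exact Or.inr (Or.inl ⟨hx _ a, hx _ b⟩)
    · exact Or.inr (Or.inr ⟨hx _ a, hx _ b⟩)
  · rw [maj3_iff] at hi
    have p1 : psi (i+1) = - psi i := by unfold psi; split_ifs <;> omega
    have p2 : psi (i-2) = psi i - 2 := by unfold psi; split_ifs <;> omega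
    have p3 : psi (i-4) = psi i - 4 := by unfold psi; split_ifs <;> omega
    rw [← p1, ← p2, ← p3]
    rcases hi with ⟨a, b⟩ | ⟨a, b⟩ | ⟨a, b⟩
    · exact Or.inl ⟨hx _ a, hx _ b⟩
    · exact Or.inr (Or.inl ⟨hx _ a, hx _ b⟩)
    · exact Or.inr (Or.inr ⟨hx _ a, hx _ b⟩)

lemma tlv_inv (L : ℕ) (hL : 8 ≤ L) (hev : Even L) (x : ℤ → Bool) (A : ℕ → ℤ → Prop) (T : ℕ)
    (hx : ∀ i, x i = true → A 0 (psi i))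
    (hb : ∀ t z, t ≤ T → A t z → -(L:ℤ) + 2 ≤ z ∧ z ≤ L - 2)
    (hs : ∀ t z, z % 2 = 1 → ((A t (-z) ∧ A t (z-2)) ∨ (A t (-z) ∧ A t (z-4)) ∨
      (A t (z-2) ∧ A t (z-4))) → A (t+1) z) :
    ∀ t, t ≤ T → ∀ i, (TLVbar L)^[t] x i = true → A t (psi i) := by
  intro t
  induction t with
  | zero => intro _ i hi; exact hx i hi
  | succ t ih =>
    intro ht i hi
    rw [Function.iterate_succ_apply'] at hi
    exact tlv_inv_step L hL hev _ (A t) (A (t+1)) (ih (by omega))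
      (fun z => hb t z (by omega)) (hs t) i hi

/-- Case 1 : near the boundary -/
lemma death_hull (L : ℕ) (hL : 8 ≤ L) (hev : Even L) (x : ℤ → Bool) (e : ℤ) (T : ℕ)
    (hx : ∀ i, x i = true → 1 ≤ i ∧ i ≤ e) (he : e + 2 * T + 6 ≤ L) (hT : 3 * e + 1 ≤ 2 * T) :
    ∀ i, (TLVbar L)^[T] x i = false := by
  intro i
  by_contra hi
  rw [Bool.not_eq_false] at hi
  have := tlv_inv L hL hev x (fun t z => 1 - e + 2 * t ≤ z ∧ z ≤ e + 2 * t ∧ 1 + 4 * t - 2 * e ≤ z)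
    T (by intro i hi; have := hx i hi; unfold psi; split_ifs <;> omega)
    (by intro t z ht h; omega)
    (by intro t z hz h; push_cast; omega) T le_rfl i hi
  omega

lemma death_far (L : ℕ) (hL : 8 ≤ L) (hev : Even L) (x : ℤ → Bool) (c e : ℤ) (T : ℕ)
    (hc : 1 ≤ c)
    (hx : ∀ i, x i = true → c ≤ i ∧ i ≤ e) (he : e + 2 * T + 6 ≤ L)
    (hf : 3 * (e - c) + 12 < 2 * c) (hT : 2 * (e - c) + 16 ≤ T) :
    ∀ i, (TLVbar L)^[T] x i = false := by
  intro i
  by_contra hi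
  rw [Bool.not_eq_false] at hi
  have hce := hx
  have := tlv_inv L hL hev x (fun t z =>
      (c + 2 * t ≤ z ∧ z ≤ e + 2 * t ∧ 2 * c + 8 * t - (e - c) - 1 ≤ 2 * z) ∨
      (1 - e + 2 * t ≤ z ∧ z ≤ 1 - c + 2 * t ∧ 2 * (1 - e) + 8 * t - (e - c) - 1 ≤ 2 * z))
    T (by intro i hi; have := hx i hi; unfold psi; split_ifs <;> omega)
    (by intro t z ht h; rcases h with h | h <;> omega)
    (by
      intro t z hz h; push_cast
      rcases h with ⟨h1 | h1, h2 | h2⟩ | ⟨h1 | h1, h2 | h2⟩ | ⟨h1 | h1, h2 | h2⟩ <;> omega)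
    T le_rfl i hi
  omega

lemma death_mid (L : ℕ) (hL : 8 ≤ L) (hev : Even L) (x : ℤ → Bool) (c e : ℤ) (T : ℕ)
    (hc : 1 ≤ c) (hce : c ≤ e)
    (hx : ∀ i, x i = true → c ≤ i ∧ i ≤ e) (he : e + 2 * T + 6 ≤ L)
    (hf : 2 * c ≤ 3 * (e - c) + 12) (hn : (e - c) + 20 < 4 * c) (hT : 2 * (e - c) + 16 ≤ T) :
    ∀ i, (TLVbar L)^[T] x i = false := by
  intro i
  by_contra hi
  rw [Bool.not_eq_false] at hi
  have := tlv_inv L hL hev x (fun t z =>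
      (c + 2 * t ≤ z ∧ z ≤ e + 2 * t ∧ 2 * c + 8 * t - (e - c) - 1 ≤ 2 * z) ∨
      (1 - e + 2 * t ≤ z ∧ 1 + 4 * t - 2 * e ≤ z ∧ 3 * z ≤ 6 * t + (e - c) - 3 * c + 12 ∧
        (z ≤ 1 - c + 2 * t ∨ z ≤ 4 * t - 2 * c + 4)))
    T (by intro i hi; have := hx i hi; unfold psi; split_ifs <;> omega)
    (by intro t z ht h; rcases h with h | h <;> omega)
    (by
      intro t z hz h; push_cast
      rcases h with ⟨h1 | h1, h2 | h2⟩ | ⟨h1 | h1, h2 | h2⟩ | ⟨h1 | h1, h2 | h2⟩ <;> omega)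
    T le_rfl i hi
  omega

lemma death_left (L : ℕ) (hL : 8 ≤ L) (hev : Even L) (x : ℤ → Bool) (c e : ℤ) (T : ℕ)
    (hc : 1 ≤ c) (hce : c ≤ e)
    (hx : ∀ i, x i = true → c ≤ i ∧ i ≤ e) (he : e + 2 * T + 6 ≤ L)
    (hT : 2 * (e - c) + 16 ≤ T) :
    ∀ i, (TLVbar L)^[T] x i = false := by
  by_cases h1 : (e - c) + 20 < 4 * c
  · by_cases h2 : 2 * c ≤ 3 * (e - c) + 12
    · exact death_mid L hL hev x c e T hc hce hx he h2 h1 hT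
    · exact death_far L hL hev x c e T hc hx he (by omega) hT
  · exact death_hull L hL hev x e T (fun i hi => by have := hx i hi; omega) he (by omega)

lemma tlv_refl (L : ℕ) (hL : 8 ≤ L) (hev : Even L) (x : ℤ → Bool) :
    TLVbar L (fun i => x (L + 1 - i)) = fun i => TLVbar L x (L + 1 - i) := by
  obtain ⟨n, hn⟩ := hev
  funext i
  simp only [TLVbar]
  by_cases h0 : i < 1 ∨ (L:ℤ) < i
  · rw [if_pos h0, if_pos (by omega)]
  rw [if_neg h0, if_neg (by omega : ¬ ((L:ℤ) + 1 - i < 1 ∨ (L:ℤ) < L + 1 - i))]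
  by_cases h1 : i = 1
  · rw [if_pos h1, if_neg (by omega), if_neg (by omega), if_pos (by omega)]
    congr 2 <;> ring
  by_cases h2 : i = 3
  · rw [if_neg h1, if_pos h2, if_neg (by omega), if_neg (by omega), if_neg (by omega),
      if_pos (by omega)]
    congr 2 <;> ring
  by_cases h3 : i = L
  · rw [if_neg h1, if_neg h2, if_pos h3, if_pos (by omega)]
    congr 2 <;> ring
  by_cases h4 : i = L - 2
  · rw [if_neg h1, if_neg h2, if_neg h3, if_pos h4, if_neg (by omega), if_pos (by omega)]
    congr 2 <;> ring
  rw [if_neg h1, if_neg h2, if_neg h3, if_neg h4,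
    if_neg (show ¬ (L:ℤ) + 1 - i = 1 by omega), if_neg (show ¬ (L:ℤ) + 1 - i = 3 by omega),
    if_neg (show ¬ (L:ℤ) + 1 - i = L by omega), if_neg (show ¬ (L:ℤ) + 1 - i = L - 2 by omega)]
  by_cases h5 : i % 2 = 0
  · rw [if_pos h5, if_neg (by omega)]
    congr 2 <;> ring
  · rw [if_neg h5, if_pos (by omega)]
    congr 2 <;> ring

lemma tlv_refl_iter (L : ℕ) (hL : 8 ≤ L) (hev : Even L) (x : ℤ → Bool) (t : ℕ) :
    (TLVbar L)^[t] (fun i => x (L + 1 - i)) = fun i => (TLVbar L)^[t] x (L + 1 - i) := by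
  induction t with
  | zero => rfl
  | succ t ih =>
    rw [Function.iterate_succ_apply', ih, tlv_refl L hL hev, Function.iterate_succ_apply']

lemma death (L : ℕ) (hev : Even L) (x : ℤ → Bool) (u : ℤ) (r T : ℕ)
    (hu : 1 ≤ u ∧ u ≤ L)
    (hx : ∀ i, x i = true → (1 ≤ i ∧ i ≤ L) ∧ |i - u| ≤ r) (hL : 8 * T ≤ L)
    (hT : 4 * r + 16 ≤ T) :
    ∀ i, (TLVbar L)^[T] x i = false := by
  by_cases h : 2 * u ≤ L + 1
  · apply death_left L (by omega) hev x (max 1 (u - r)) (u + r) T (le_max_left _ _)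
      (by omega) _ (by omega) (by omega)
    intro i hi
    have := hx i hi
    rw [abs_le] at this
    omega
  · have key := death_left L (by omega) hev (fun i => x (L + 1 - i)) (max 1 (L + 1 - u - r))
      (L + 1 - u + r) T (le_max_left _ _)
      (by omega) (by
        intro i hi
        have := hx _ hi
        rw [abs_le] at this
        omega) (by omega) (by omega)
    rw [tlv_refl_iter L (by omega) hev] at key
    intro i
    have := key (L + 1 - i)
    simpa using this

lemma tlv_speed_step (L : ℕ) (hL : 8 ≤ L) (x : ℤ → Bool) (i : ℤ)
    (hi : TLVbar L x i = true) : ∃ j, x j = true ∧ |i - j| ≤ 2 := by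
  unfold TLVbar at hi
  have fin : ∀ j, x j = true → -2 ≤ i - j ∧ i - j ≤ 2 → ∃ j, x j = true ∧ |i - j| ≤ 2 :=
    fun j h1 h2 => ⟨j, h1, abs_le.2 h2⟩
  split_ifs at hi with h1 h2 h3 h4 h5 h6 <;> rw [maj3_iff] at hi <;>
    rcases hi with ⟨a, b⟩ | ⟨a, b⟩ | ⟨a, b⟩ <;>
    first | exact fin _ a (by omega) | exact fin _ b (by omega)

lemma tlv_speed (L : ℕ) (hL : 8 ≤ L) (x : ℤ → Bool) (t : ℕ) : ∀ i : ℤ,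
    (TLVbar L)^[t] x i = true → ∃ j, x j = true ∧ |i - j| ≤ 2 * t := by
  induction t with
  | zero => intro i hi; exact ⟨i, hi, by simp⟩
  | succ t ih =>
    intro i hi
    rw [Function.iterate_succ_apply'] at hi
    obtain ⟨j, hj, hij⟩ := tlv_speed_step L hL _ i hi
    obtain ⟨k, hk, hjk⟩ := ih j hj
    refine ⟨k, hk, ?_⟩
    rw [abs_le] at *
    push_cast
    omega

lemma maj3_or (a b c a' b' c' : Bool)
    (h1 : a = true → b' = true → False) (h2 : a = true → c' = true → False)
    (h3 : b = true → a' = true → False) (h4 : b = true → c' = true → False)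
    (h5 : c = true → a' = true → False) (h6 : c = true → b' = true → False) :
    maj3 (a || a') (b || b') (c || c') = (maj3 a b c || maj3 a' b' c') := by
  cases a <;> cases b <;> cases c <;> cases a' <;> cases b' <;> cases c' <;> simp_all [maj3]

lemma tlv_add_step (L : ℕ) (hL : 8 ≤ L) (x y : ℤ → Bool)
    (h : ∀ i j, x i = true → y j = true → 6 ≤ |i - j|) :
    TLVbar L (fun i => x i || y i) = fun i => TLVbar L x i || TLVbar L y i := by
  funext i
  have h' : ∀ i j, -5 ≤ i - j ∧ i - j ≤ 5 → x i = true → y j = true → False := by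
    intro i j hij h1 h2
    have := h i j h1 h2
    have : |i - j| ≤ 5 := abs_le.2 hij
    omega
  simp only [TLVbar]
  split_ifs
  · rfl
  all_goals
    apply maj3_or <;> apply h' <;> omega

lemma tlv_add (L : ℕ) (hL : 8 ≤ L) (x y : ℤ → Bool) (T : ℕ)
    (h : ∀ i j, x i = true → y j = true → 4 * (T:ℤ) + 6 ≤ |i - j|) :
    ∀ t, t ≤ T → (TLVbar L)^[t] (fun i => x i || y i) =
      fun i => (TLVbar L)^[t] x i || (TLVbar L)^[t] y i := by
  intro t
  induction t with
  | zero => intro _; rfl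
  | succ t ih =>
    intro ht
    rw [Function.iterate_succ_apply', ih (by omega), tlv_add_step L hL,
      Function.iterate_succ_apply', Function.iterate_succ_apply']
    intro i j hi hj
    obtain ⟨i', hi', hii⟩ := tlv_speed L hL x t i hi
    obtain ⟨j', hj', hjj⟩ := tlv_speed L hL y t j hj
    have := h i' j' hi' hj'
    by_contra hc
    push Not at hc
    rw [abs_lt] at hc
    rw [abs_le] at hii hjj
    rw [le_abs] at this
    omega

/-- indicator -/
def ind (S : Finset ℤ) : ℤ → Bool := fun j => decide (j ∈ S)

lemma sparse (L : ℕ) (hev : Even L) (r T : ℕ) (hL : 8 * T ≤ L) (hT : 4 * r + 16 ≤ T)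
    (S : Finset ℤ) (hS : S ⊆ Finset.Icc (1:ℤ) L) :
    ∃ S' ⊆ S, (TLVbar L)^[T] (ind S) = (TLVbar L)^[T] (ind S') ∧
      ∀ u ∈ S', ∃ v ∈ S', (r:ℤ) < |u - v| ∧ |u - v| ≤ r + (4 * T + 5) := by
  induction S using Finset.strongInduction with
  | H S ih =>
    by_cases h : ∀ u ∈ S, ∃ v ∈ S, (r:ℤ) < |u - v| ∧ |u - v| ≤ r + (4 * T + 5)
    · exact ⟨S, subset_rfl, rfl, h⟩
    push Not at h
    obtain ⟨u, hu, hv⟩ := h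
    set I := S.filter (fun v => |v - u| ≤ r) with hI
    set J := S.filter (fun v => ¬ |v - u| ≤ r) with hJ
    have hJS : J ⊂ S := by
      refine Finset.ssubset_iff_subset_ne.2 ⟨Finset.filter_subset _ _, ?_⟩
      intro hh
      rw [← hh, hJ, Finset.mem_filter] at hu
      simp at hu
    obtain ⟨S', hS', h1, h2⟩ := ih J hJS (hJS.1.trans hS)
    refine ⟨S', hS'.trans hJS.1, ?_, h2⟩
    rw [← h1]
    have hsplit : ind S = fun i => ind I i || ind J i := by
      funext i
      simp only [ind, hI, hJ, Finset.mem_filter]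
      by_cases a : i ∈ S <;> by_cases b : |i - u| ≤ r <;> simp [a, b]
    have hSm : ∀ i ∈ S, 1 ≤ i ∧ i ≤ L := fun i hi => Finset.mem_Icc.1 (hS hi)
    rw [hsplit, tlv_add L (by omega) (ind I) (ind J) T _ T le_rfl]
    · funext i
      rw [death L hev (ind I) u r T (hSm u hu) _ hL hT]
      · simp
      · intro i hi
        simp only [ind, hI, Finset.mem_filter, decide_eq_true_eq] at hi
        exact ⟨hSm i hi.1, hi.2⟩
    · intro i j hi hj
      simp only [ind, hI, hJ, Finset.mem_filter, decide_eq_true_eq] at hi hj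
      have h3 := hv j hj.1 (by rw [abs_sub_comm]; omega)
      have h4 := hi.2
      rw [abs_le] at h4
      rw [lt_abs] at h3
      rw [le_abs]
      omega

/-- radii -/
def Rad : ℕ → ℕ
  | 0 => 0
  | k+1 => 35 * Rad k + 69

lemma Rad_eq (k : ℕ) : 34 * Rad k + 69 = 69 * 35 ^ k := by
  induction k with
  | zero => rfl
  | succ k ih => rw [Rad, pow_succ]; omega

/-- cluster trees -/
def CTree (S : Finset ℤ) : ℕ → ℤ → Prop
  | 0, u => u ∈ S
  | k+1, u => CTree S k u ∧ ∃ v, (2 * Rad k : ℤ) < |u - v| ∧ |u - v| ≤ 69 * 35 ^ k ∧ CTree S k v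

lemma exists_tree (L : ℕ) (hev : Even L) (S : Finset ℤ) (hS : S ⊆ Finset.Icc (1:ℤ) L)
    (t : ℕ) (k : ℕ) (hk : k = 0 ∨ (35 ^ k ≤ t ∧ 8 * 35 ^ k ≤ L)) :
    ∃ S' ⊆ S, (TLVbar L)^[t] (ind S) = (TLVbar L)^[t] (ind S') ∧ ∀ u ∈ S', CTree S k u := by
  induction k with
  | zero => exact ⟨S, subset_rfl, rfl, fun u hu => hu⟩
  | succ k ih =>
    have hk' : 35 ^ (k+1) ≤ t ∧ 8 * 35 ^ (k+1) ≤ L := by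
      rcases hk with h | h
      · omega
      · exact h
    rw [pow_succ] at hk'
    obtain ⟨S1, hS1, e1, t1⟩ := ih (Or.inr (by omega))
    have hR := Rad_eq k
    have h1 : 1 ≤ 35 ^ k := Nat.one_le_pow _ _ (by norm_num)
    obtain ⟨S2, hS2, e2, t2⟩ := sparse L hev (2 * Rad k) (8 * Rad k + 16) (by omega) (by omega)
      S1 (hS1.trans hS)
    refine ⟨S2, hS2.trans hS1, ?_, ?_⟩
    · rw [e1]
      obtain ⟨s, hs⟩ : ∃ s, t = s + (8 * Rad k + 16) := ⟨t - (8 * Rad k + 16), by omega⟩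
      rw [hs, Function.iterate_add_apply _ s, Function.iterate_add_apply _ s, e2]
    · intro u hu
      obtain ⟨v, hv, h3, h4⟩ := t2 u hu
      refine ⟨t1 u (hS2 hu), v, by push_cast at h3; exact h3, ?_, t1 v (hS2 hv)⟩
      have hR' : (34 * Rad k + 69 : ℤ) = 69 * 35 ^ k := by exact_mod_cast hR
      rw [← hR']
      push_cast at h4
      omega

lemma tlv_empty (L t : ℕ) (i : ℤ) : (TLVbar L)^[t] (ind ∅) i = false := by
  have h : TLVbar L (ind ∅) = ind ∅ := by
    funext i
    simp [TLVbar, ind, maj3]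
  rw [Function.iterate_fixed h]
  simp [ind]

lemma root_of_nonempty (L : ℕ) (hev : Even L) (S : Finset ℤ) (hS : S ⊆ Finset.Icc (1:ℤ) L)
    (t : ℕ) (k : ℕ) (hk : k = 0 ∨ (35 ^ k ≤ t ∧ 8 * 35 ^ k ≤ L))
    (hne : ∃ i : ℤ, (TLVbar L)^[t] (fun j => decide (j ∈ S)) i = true) :
    ∃ u ∈ Finset.Icc (1:ℤ) L, CTree S k u := by
  obtain ⟨S', h1, h2, h3⟩ := exists_tree L hev S hS t k hk
  obtain ⟨i, hi⟩ := hne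
  change (TLVbar L)^[t] (ind S) i = true at hi
  rw [h2] at hi
  rcases S'.eq_empty_or_nonempty with rfl | ⟨u, hu⟩
  · rw [tlv_empty] at hi; cases hi
  · exact ⟨u, hS (h1 hu), h3 u hu⟩

/-- the finite family of candidate clusters -/
noncomputable def Fam : ℕ → ℤ → Finset (Finset ℤ)
  | 0, u => {{u}}
  | k+1, u => ((Finset.Icc (u - 69 * 35 ^ k) (u + 69 * 35 ^ k)).filter
        (fun v => (2 * Rad k : ℤ) < |u - v|)).biUnion
      (fun v => Finset.image₂ (· ∪ ·) (Fam k u) (Fam k v))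

lemma Fam_card_point (k : ℕ) : ∀ u : ℤ, ∀ A ∈ Fam k u, A.card = 2 ^ k ∧ ∀ a ∈ A, |a - u| ≤ Rad k := by
  induction k with
  | zero =>
    intro u A hA
    simp only [Fam, Finset.mem_singleton] at hA
    subst hA
    simp [Rad]
  | succ k ih =>
    intro u A hA
    simp only [Fam, Finset.mem_biUnion, Finset.mem_filter, Finset.mem_Icc, Finset.mem_image₂] at hA
    obtain ⟨v, ⟨hv1, hv2⟩, B, hB, C, hC, rfl⟩ := hA
    obtain ⟨b1, b2⟩ := ih u B hB
    obtain ⟨c1, c2⟩ := ih v C hC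
    constructor
    · rw [Finset.card_union_of_disjoint, b1, c1, pow_succ]
      · ring
      · rw [Finset.disjoint_left]
        intro a ha ha'
        have h1 := b2 a ha
        have h2 := c2 a ha'
        rw [abs_le] at h1 h2
        rw [lt_abs] at hv2
        omega
    · have hR' : (34 * Rad k + 69 : ℤ) = 69 * 35 ^ k := by exact_mod_cast Rad_eq k
      rw [← hR'] at hv1
      intro a ha
      rw [Finset.mem_union] at ha
      rw [Rad]
      push_cast
      rcases ha with ha | ha
      · have := b2 a ha
        rw [abs_le] at *
        omega
      · have := c2 a ha
        rw [abs_le] at *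
        omega

lemma Fam_card (k : ℕ) : ∀ u : ℤ, (Fam k u).card * (139 * 35 ^ (k+1)) ≤ 4865 ^ (2 ^ k) := by
  induction k with
  | zero => intro u; simp [Fam]
  | succ k ih =>
    intro u
    obtain ⟨N, hN1, hN2⟩ : ∃ N : ℕ, (∀ v, (Fam k v).card ≤ N) ∧
        N * (139 * 35 ^ (k+1)) ≤ 4865 ^ (2 ^ k) := by
      refine ⟨4865 ^ (2 ^ k) / (139 * 35 ^ (k+1)), fun v => ?_, Nat.div_mul_le_self _ _⟩
      rw [Nat.le_div_iff_mul_le (by positivity)]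
      exact ih v
    have h1 : (Fam (k+1) u).card ≤ (139 * 35 ^ k) * (N * N) := by
      rw [Fam]
      refine (Finset.card_biUnion_le_card_mul _ _ (N * N) ?_).trans ?_
      · intro v _
        exact (Finset.card_image₂_le _ _ _).trans (Nat.mul_le_mul (hN1 _) (hN1 _))
      · apply Nat.mul_le_mul_right
        refine (Finset.card_filter_le _ _).trans ?_
        rw [Int.card_Icc]
        have : (1:ℤ) ≤ 35 ^ k := one_le_pow₀ (by norm_num)
        zify
        rw [Int.toNat_of_nonneg (by omega)]
        omega
    calc (Fam (k+1) u).card * (139 * 35 ^ (k+1+1))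
        ≤ ((139 * 35 ^ k) * (N * N)) * (139 * 35 ^ (k+1+1)) := Nat.mul_le_mul_right _ h1
      _ = (N * (139 * 35 ^ (k+1))) ^ 2 := by ring
      _ ≤ (4865 ^ (2 ^ k)) ^ 2 := Nat.pow_le_pow_left hN2 2
      _ = 4865 ^ (2 ^ (k+1)) := by rw [← pow_mul, pow_succ]

lemma Fam_card' (k : ℕ) (u : ℤ) : (Fam k u).card ≤ 4865 ^ (2 ^ k) :=
  le_trans (Nat.le_mul_of_pos_right _ (by positivity)) (Fam_card k u)

lemma CTree_Fam (S : Finset ℤ) (k : ℕ) : ∀ u, CTree S k u → ∃ A ∈ Fam k u, A ⊆ S := by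
  induction k with
  | zero =>
    intro u hu
    exact ⟨{u}, by simp [Fam], Finset.singleton_subset_iff.2 hu⟩
  | succ k ih =>
    rintro u ⟨hu, v, hv1, hv2, hv⟩
    obtain ⟨A, hA, hA'⟩ := ih u hu
    obtain ⟨B, hB, hB'⟩ := ih v hv
    refine ⟨A ∪ B, ?_, Finset.union_subset hA' hB'⟩
    simp only [Fam, Finset.mem_biUnion, Finset.mem_filter, Finset.mem_Icc]
    rw [abs_le] at hv2
    exact ⟨v, ⟨by constructor <;> linarith, hv1⟩, Finset.mem_image₂_of_mem hA hB⟩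

lemma prob_superset (p : ℝ) (hp0 : 0 ≤ p) (hp1 : p ≤ 1) (U A : Finset ℤ) :
    ∑ E ∈ U.powerset.filter (fun E => A ⊆ E), p ^ E.card * (1 - p) ^ (U.card - E.card)
      ≤ p ^ A.card := by
  by_cases hA : A ⊆ U
  · have h : U.powerset.filter (fun E => A ⊆ E) = (U \ A).powerset.image (fun F => A ∪ F) := by
      ext E
      simp only [Finset.mem_filter, Finset.mem_powerset, Finset.mem_image]
      constructor
      · rintro ⟨h1, h2⟩
        exact ⟨E \ A, Finset.sdiff_subset_sdiff h1 le_rfl, Finset.union_sdiff_of_subset h2⟩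
      · rintro ⟨F, hF, rfl⟩
        exact ⟨Finset.union_subset hA (hF.trans Finset.sdiff_subset), Finset.subset_union_left⟩
    have hd : ∀ F ∈ (U \ A).powerset, Disjoint A F := fun F hF =>
      Finset.disjoint_of_subset_right (Finset.mem_powerset.1 hF) Finset.disjoint_sdiff
    rw [h, Finset.sum_image]
    · have : ∀ F ∈ (U \ A).powerset, p ^ (A ∪ F).card * (1 - p) ^ (U.card - (A ∪ F).card)
          = p ^ A.card * (p ^ F.card * (1 - p) ^ ((U \ A).card - F.card)) := by
        intro F hF
        rw [Finset.card_union_of_disjoint (hd F hF), Finset.card_sdiff_of_subset hA, pow_add,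
          Nat.sub_sub, mul_assoc]
      rw [Finset.sum_congr rfl this, ← Finset.mul_sum, Finset.sum_pow_mul_eq_add_pow]
      simp
    · intro F hF G hG hFG
      have h1 := hd F hF
      have h2 := hd G hG
      have e1 : (A ∪ F) \ A = F := Finset.union_sdiff_cancel_left h1
      have e2 : (A ∪ G) \ A = G := Finset.union_sdiff_cancel_left h2
      rw [← e1, ← e2]
      exact congrArg (· \ A) hFG
  · rw [Finset.sum_eq_zero]
    · positivity
    · intro E hE
      simp only [Finset.mem_filter, Finset.mem_powerset] at hE
      exact absurd (hE.2.trans hE.1) hA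

lemma prob_bound (p : ℝ) (hp0 : 0 ≤ p) (hp1 : p ≤ 1) (L : ℕ) (hev : Even L) (t k : ℕ)
    (hk : k = 0 ∨ (35 ^ k ≤ t ∧ 8 * 35 ^ k ≤ L)) :
    TLVbarNonemptyProb p L t ≤ L * (4865 * p) ^ (2 ^ k) := by
  classical
  have hq : 0 ≤ 1 - p := by linarith
  set U := Finset.Icc (1:ℤ) L with hU
  have hUc : U.card = L := by simp [hU]
  let W : Finset ℤ → ℝ := fun E => p ^ E.card * (1 - p) ^ (L - E.card)
  have hW : ∀ E, 0 ≤ W E := fun E => by positivity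
  have h1 : TLVbarNonemptyProb p L t ≤
      ∑ E ∈ U.powerset, ∑ u ∈ U, ∑ A ∈ Fam k u, if A ⊆ E then W E else 0 := by
    unfold TLVbarNonemptyProb
    apply Finset.sum_le_sum
    intro E hE
    have hnn : ∀ u ∈ U, 0 ≤ ∑ A ∈ Fam k u, if A ⊆ E then W E else 0 := fun u _ =>
      Finset.sum_nonneg (fun A _ => by split_ifs; exacts [hW E, le_rfl])
    split_ifs with h
    · obtain ⟨u, hu, hT⟩ := root_of_nonempty L hev E (Finset.mem_powerset.1 hE) t k hk h
      obtain ⟨A, hA, hAE⟩ := CTree_Fam E k u hT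
      refine le_trans ?_ (Finset.single_le_sum hnn hu)
      refine le_trans ?_ (Finset.single_le_sum (f := fun A => if A ⊆ E then W E else 0)
        (fun A _ => by split_ifs; exacts [hW E, le_rfl]) hA)
      simp [hAE, W]
    · exact Finset.sum_nonneg hnn
  refine h1.trans ?_
  rw [Finset.sum_comm]
  have h2 : ∀ u ∈ U, ∑ E ∈ U.powerset, ∑ A ∈ Fam k u, (if A ⊆ E then W E else 0)
      ≤ (4865 * p) ^ (2 ^ k) := by
    intro u _
    rw [Finset.sum_comm]
    have h3 : ∀ A ∈ Fam k u, ∑ E ∈ U.powerset, (if A ⊆ E then W E else 0) ≤ p ^ (2 ^ k) := by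
      intro A hA
      rw [← Finset.sum_filter, ← (Fam_card_point k u A hA).1]
      have := prob_superset p hp0 hp1 U A
      rw [hUc] at this
      exact this
    refine (Finset.sum_le_card_nsmul _ _ _ h3).trans ?_
    rw [nsmul_eq_mul, mul_pow]
    apply mul_le_mul_of_nonneg_right _ (by positivity)
    exact_mod_cast Fam_card' k u
  refine (Finset.sum_le_card_nsmul _ _ _ h2).trans ?_
  rw [nsmul_eq_mul, hUc]

lemma prob_le_one (p : ℝ) (hp0 : 0 ≤ p) (hp1 : p ≤ 1) (L t : ℕ) :
    TLVbarNonemptyProb p L t ≤ 1 := by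
  classical
  have hq : 0 ≤ 1 - p := by linarith
  have := Finset.sum_pow_mul_eq_add_pow p (1 - p) (Finset.Icc (1:ℤ) L)
  have h2 : (Finset.Icc (1:ℤ) L).card = L := by simp
  rw [h2] at this
  have e : (p + (1 - p)) ^ L = 1 := by simp
  rw [← e, ← this]
  unfold TLVbarNonemptyProb
  apply Finset.sum_le_sum
  intro E _
  split_ifs
  · exact le_rfl
  · positivity

/-- Decoding on the finite chain: for the finite mirrored TLV automaton on `{1,…,L}`
(`L` even) with Bernoulli(`p`) initial configuration, with `β = ln 2 / ln 35`,
`α = 560·√p`, `γ = -ln α` and `{t} = min(t, ⌊L/8⌋)`, the probability that the state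
at time `t` is nonempty is at most `(16·{t} + L)·exp(-γ·{t}^β)`. -/
theorem TLVbar_decoding_bound (p : ℝ) (hp0 : 0 ≤ p) (hp1 : p ≤ 1)
    (L : ℕ) (hLpos : 0 < L) (hLeven : Even L) (t : ℕ) :
    TLVbarNonemptyProb p L t
      ≤ (16 * (min t (L / 8) : ℕ) + (L : ℝ))
          * Real.exp (-((-Real.log (560 * Real.sqrt p))
              * ((min t (L / 8) : ℕ) : ℝ) ^ (Real.log 2 / Real.log 35))) := by
  have hL1 : (1:ℝ) ≤ L := by exact_mod_cast hLpos
  set m : ℕ := min t (L / 8) with hm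
  set β : ℝ := Real.log 2 / Real.log 35 with hβ
  have hl2 : 0 < Real.log 2 := Real.log_pos (by norm_num)
  have hl35 : 0 < Real.log 35 := Real.log_pos (by norm_num)
  have hβ0 : 0 < β := div_pos hl2 hl35
  have hm0 : (0:ℝ) ≤ (m:ℝ) := Nat.cast_nonneg _
  have hmb : 0 ≤ (m:ℝ) ^ β := Real.rpow_nonneg hm0 _
  -- trivial case
  have triv : 0 ≤ Real.log (560 * Real.sqrt p) * (m:ℝ) ^ β →
      TLVbarNonemptyProb p L t ≤ (16 * (m : ℝ) + (L : ℝ)) *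
        Real.exp (-((-Real.log (560 * Real.sqrt p)) * (m:ℝ) ^ β)) := by
    intro h
    refine (prob_le_one p hp0 hp1 L t).trans ?_
    have h1 : 1 ≤ Real.exp (-((-Real.log (560 * Real.sqrt p)) * (m:ℝ) ^ β)) := by
      apply Real.one_le_exp; linarith
    nlinarith
  by_cases hα : 0 ≤ Real.log (560 * Real.sqrt p)
  · exact triv (mul_nonneg hα hmb)
  rcases Nat.eq_zero_or_pos m with h0 | hmpos
  · apply triv
    rw [h0, Nat.cast_zero, Real.zero_rpow hβ0.ne', mul_zero]
  push Not at hα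
  have hp : 0 < p := by
    rcases hp0.eq_or_lt with h | h
    · rw [← h] at hα; simp at hα
    · exact h
  have hαpos : 0 < 560 * Real.sqrt p := by have := Real.sqrt_pos.2 hp; positivity
  set k := Nat.log 35 m with hk
  have hk1 : 35 ^ k ≤ m := Nat.pow_log_le_self 35 hmpos.ne'
  have hk2 : m < 35 ^ (k+1) := Nat.lt_pow_succ_log_self (by norm_num) m
  have hb := prob_bound p hp0 hp1 L hLeven t k (Or.inr (by omega))
  have hpow : (m:ℝ) ^ β ≤ 2 ^ (k+1) := by
    have h1 : (m:ℝ) ≤ (35:ℝ) ^ (k+1) := by exact_mod_cast hk2.le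
    have h35 : (35:ℝ) ^ β = 2 := by
      rw [Real.rpow_def_of_pos (by norm_num), hβ, mul_div_cancel₀ _ hl35.ne',
        Real.exp_log (by norm_num)]
    calc (m:ℝ) ^ β ≤ ((35:ℝ) ^ (k+1)) ^ β := Real.rpow_le_rpow hm0 h1 hβ0.le
      _ = ((35:ℝ) ^ β) ^ (k+1) := by
        rw [← Real.rpow_natCast, ← Real.rpow_natCast, ← Real.rpow_mul (by norm_num),
          ← Real.rpow_mul (by norm_num), mul_comm]
      _ = 2 ^ (k+1) := by rw [h35]
  have hexp : (560 ^ 2 * p) ^ (2 ^ k) ≤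
      Real.exp (-((-Real.log (560 * Real.sqrt p)) * (m:ℝ) ^ β)) := by
    have e1 : (560 ^ 2 * p) ^ (2 ^ k) = (560 * Real.sqrt p) ^ (2 ^ (k+1)) := by
      rw [pow_succ 2 k, mul_comm (2 ^ k) 2, pow_mul, mul_pow 560 (Real.sqrt p) 2, Real.sq_sqrt hp0]
    rw [e1, ← Real.exp_log (pow_pos hαpos _), Real.log_pow]
    apply Real.exp_le_exp.2
    push_cast
    nlinarith
  have h5 : (4865 * p) ^ (2 ^ k) ≤ (560 ^ 2 * p) ^ (2 ^ k) := by
    apply pow_le_pow_left₀ (by positivity)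
    nlinarith
  refine hb.trans ?_
  apply mul_le_mul _ (h5.trans hexp) (by positivity) (by positivity)
  linarith
end
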